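/- arXiv:2404.04058 — 3 statements merged into one kernel-verified Lean document; each statement's English description precedes it below -/
import Mathlib

section
/- For every natural number n ≥ 1, the defect D_n = A_n − B_n equals: 1 if n = 1; 0 if n > 1 is odd; and (−1)^{n/2} · T_{n/2} if n is even, where T_m denotes the total number of CNATs of size m. -/
/-- A complete non-ambiguous tree (CNAT) of size `n`: a dotted filling of the
`n × n` grid (`dot i j = true` means cell in row `i`, column `j` is dotted)
such that the top-left cell (the root) is dotted; every other dotted cell
(vertex) has another vertex either above it in the same column, or to its left
in the same row, but not both; every row and column contains a vertex; and the
underlying rooted binary tree is complete, i.e. every vertex has either both a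
child below it in its column and a child to its right in its row, or neither. -/
structure CNAT (n : ℕ) where
  dot : Fin n → Fin n → Bool
  root : ∀ h : 0 < n, dot ⟨0, h⟩ ⟨0, h⟩ = true
  nonambiguous : ∀ i j : Fin n, dot i j = true → ¬((i : ℕ) = 0 ∧ (j : ℕ) = 0) →
    Xor' (∃ i' : Fin n, i' < i ∧ dot i' j = true)
         (∃ j' : Fin n, j' < j ∧ dot i j' = true)
  min_row : ∀ i : Fin n, ∃ j : Fin n, dot i j = true
  min_col : ∀ j : Fin n, ∃ i : Fin n, dot i j = true
  complete : ∀ i j : Fin n, dot i j = true →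
    ((∃ i' : Fin n, i < i' ∧ dot i' j = true) ↔ (∃ j' : Fin n, j < j' ∧ dot i j' = true))

/-- The determinant of a CNAT viewed as a 0-1 matrix. -/
noncomputable def cnatDet {n : ℕ} (M : CNAT n) : ℤ :=
  Matrix.det (Matrix.of fun i j => if M.dot i j then (1 : ℤ) else 0)

/-- `cnatA n` is the number of CNATs of size `n` with determinant `1`. -/
noncomputable def cnatA (n : ℕ) : ℕ := Nat.card {M : CNAT n // cnatDet M = 1}

/-- `cnatB n` is the number of CNATs of size `n` with determinant `-1`. -/
noncomputable def cnatB (n : ℕ) : ℕ := Nat.card {M : CNAT n // cnatDet M = -1}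

/-- `cnatT n = cnatA n + cnatB n` is the total number of CNATs of size `n`. -/
noncomputable def cnatT (n : ℕ) : ℕ := cnatA n + cnatB n

/-- The defect `D n = A n - B n`. -/
noncomputable def cnatD (n : ℕ) : ℤ := (cnatA n : ℤ) - (cnatB n : ℤ)

/-- `eCount m k` is the number of `k`-element subsets of `{1, …, m}` with even sum. -/
def eCount (m k : ℕ) : ℕ :=
  ((Finset.powersetCard k (Finset.Icc 1 m)).filter fun S => Even (S.sum id)).card

/-- `oCount m k` is the number of `k`-element subsets of `{1, …, m}` with odd sum. -/
def oCount (m k : ℕ) : ℕ :=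
  ((Finset.powersetCard k (Finset.Icc 1 m)).filter fun S => Odd (S.sum id)).card

namespace CN
open Finset

lemma xor_or' {a b : Prop} (h : Xor a b) : a ∨ b := by
  rcases h with h | h
  · exact Or.inl h.1
  · exact Or.inr h.1

/-- Complete non-ambiguous tree with root `(i0, j0)` as a finite set of cells. -/
structure IsC (i0 j0 : ℕ) (S : Finset (ℕ × ℕ)) : Prop where
  root : (i0, j0) ∈ S
  le : ∀ i j, (i, j) ∈ S → i0 ≤ i ∧ j0 ≤ j
  na : ∀ i j, (i, j) ∈ S → ¬ (i = i0 ∧ j = j0) →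
    Xor (∃ i', i' < i ∧ (i', j) ∈ S) (∃ j', j' < j ∧ (i, j') ∈ S)
  co : ∀ i j, (i, j) ∈ S →
    ((∃ i', i < i' ∧ (i', j) ∈ S) ↔ (∃ j', j < j' ∧ (i, j') ∈ S))

inductive Lft (i0 j0 : ℕ) (S : Finset (ℕ × ℕ)) : ℕ → ℕ → Prop
  | base (i : ℕ) : (i, j0) ∈ S → i0 < i → Lft i0 j0 S i j0
  | down (i i' j : ℕ) : Lft i0 j0 S i j → i < i' → (i', j) ∈ S → Lft i0 j0 S i' j
  | right (i j j' : ℕ) : Lft i0 j0 S i j → j < j' → (i, j') ∈ S → Lft i0 j0 S i j'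

inductive Rgt (i0 j0 : ℕ) (S : Finset (ℕ × ℕ)) : ℕ → ℕ → Prop
  | base (j : ℕ) : (i0, j) ∈ S → j0 < j → Rgt i0 j0 S i0 j
  | down (i i' j : ℕ) : Rgt i0 j0 S i j → i < i' → (i', j) ∈ S → Rgt i0 j0 S i' j
  | right (i j j' : ℕ) : Rgt i0 j0 S i j → j < j' → (i, j') ∈ S → Rgt i0 j0 S i j'

section
variable {i0 j0 : ℕ} {S : Finset (ℕ × ℕ)}

lemma Lft.mem {i j : ℕ} (h : Lft i0 j0 S i j) : (i, j) ∈ S := by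
  cases h <;> assumption

lemma Rgt.mem {i j : ℕ} (h : Rgt i0 j0 S i j) : (i, j) ∈ S := by
  cases h <;> assumption

lemma Lft.row {i j : ℕ} (h : Lft i0 j0 S i j) : i0 < i := by
  induction h <;> omega

lemma Rgt.col {i j : ℕ} (h : Rgt i0 j0 S i j) : j0 < j := by
  induction h <;> omega

lemma Lft.exists_base {i j : ℕ} (h : Lft i0 j0 S i j) : ∃ i, i0 < i ∧ (i, j0) ∈ S := by
  induction h with
  | base i h1 h2 => exact ⟨i, h2, h1⟩
  | down => assumption
  | right => assumption

lemma Rgt.exists_base {i j : ℕ} (h : Rgt i0 j0 S i j) : ∃ j, j0 < j ∧ (i0, j) ∈ S := by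
  induction h with
  | base i h1 h2 => exact ⟨i, h2, h1⟩
  | down => assumption
  | right => assumption

lemma Lft.le_of {i1 i j : ℕ} (h1 : ∀ i, i0 < i → (i, j0) ∈ S → i1 ≤ i)
    (h : Lft i0 j0 S i j) : i1 ≤ i ∧ j0 ≤ j := by
  induction h with
  | base i h2 h3 => exact ⟨h1 i h3 h2, le_rfl⟩
  | down => omega
  | right => omega

lemma Rgt.le_of {j1 i j : ℕ} (h1 : ∀ j, j0 < j → (i0, j) ∈ S → j1 ≤ j)
    (h : Rgt i0 j0 S i j) : i0 ≤ i ∧ j1 ≤ j := by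
  induction h with
  | base i h2 h3 => exact ⟨le_rfl, h1 i h3 h2⟩
  | down => omega
  | right => omega

lemma lft_or_rgt (hS : IsC i0 j0 S) : ∀ m i j : ℕ, i + j = m → (i, j) ∈ S → ¬ (i = i0 ∧ j = j0) →
    Lft i0 j0 S i j ∨ Rgt i0 j0 S i j := by
  intro m
  induction m using Nat.strong_induction_on with
  | _ m ih =>
    intro i j hm hij hne
    have hle := hS.le i j hij
    by_cases hj : j = j0
    · subst hj
      exact Or.inl (.base i hij (by omega))
    by_cases hi : i = i0
    · subst hi
      exact Or.inr (.base j hij (by omega))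
    rcases xor_or' (hS.na i j hij hne) with ⟨i', h1, h2⟩ | ⟨j', h1, h2⟩
    · rcases ih (i' + j) (by omega) i' j rfl h2 (by omega) with h | h
      · exact Or.inl (.down _ _ _ h h1 hij)
      · exact Or.inr (.down _ _ _ h h1 hij)
    · rcases ih (i + j') (by omega) i j' rfl h2 (by omega) with h | h
      · exact Or.inl (.right _ _ _ h h1 hij)
      · exact Or.inr (.right _ _ _ h h1 hij)

lemma lft_rgt_disj (hS : IsC i0 j0 S) : ∀ m i j : ℕ, i + j = m →
    Lft i0 j0 S i j → Rgt i0 j0 S i j → False := by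
  intro m
  induction m using Nat.strong_induction_on with
  | _ m ih =>
    intro i j hm hl hr
    have hrow := hl.row
    have hcol := hr.col
    have hx := hS.na i j hl.mem (by omega)
    cases hl with
    | base _ => omega
    | down i1 _ _ h1 h2 _ =>
      cases hr with
      | base => omega
      | down i2 _ _ h3 h4 _ =>
        rcases lt_trichotomy i1 i2 with h | h | h
        · exact ih (i2 + j) (by omega) i2 j rfl (.down _ _ _ h1 h h3.mem) h3
        · subst h; exact ih (i1 + j) (by omega) i1 j rfl h1 h3
        · exact ih (i1 + j) (by omega) i1 j rfl h1 (.down _ _ _ h3 h h1.mem)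
      | right _ j2 _ h3 h4 _ =>
        rcases hx with ⟨_, h⟩ | ⟨_, h⟩
        · exact h ⟨j2, h4, h3.mem⟩
        · exact h ⟨i1, h2, h1.mem⟩
    | right _ j1 _ h1 h2 _ =>
      cases hr with
      | base => omega
      | down i2 _ _ h3 h4 _ =>
        rcases hx with ⟨_, h⟩ | ⟨_, h⟩
        · exact h ⟨j1, h2, h1.mem⟩
        · exact h ⟨i2, h4, h3.mem⟩
      | right _ j2 _ h3 h4 _ =>
        rcases lt_trichotomy j1 j2 with h | h | h
        · exact ih (i + j2) (by omega) i j2 rfl (.right _ _ _ h1 h h3.mem) h3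
        · subst h; exact ih (i + j1) (by omega) i j1 rfl h1 h3
        · exact ih (i + j1) (by omega) i j1 rfl h1 (.right _ _ _ h3 h h1.mem)

/-- `S` is the tree with root `(i0,j0)` and subtrees `S1` (below) and `S2` (right). -/
structure Dec (i0 j0 : ℕ) (S S1 S2 : Finset (ℕ × ℕ)) : Prop where
  eq : S = insert (i0, j0) (S1 ∪ S2)
  row1 : ∀ i j, (i, j) ∈ S1 → i0 < i
  col2 : ∀ i j, (i, j) ∈ S2 → j0 < j
  rows : ∀ i j j', (i, j) ∈ S1 → (i, j') ∈ S2 → False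
  cols : ∀ i i' j, (i, j) ∈ S1 → (i', j) ∈ S2 → False
  c1 : ∃ i1, IsC i1 j0 S1
  c2 : ∃ j1, IsC i0 j1 S2

open Classical in
lemma exists_dec (hS : IsC i0 j0 S) (hne : S ≠ {(i0, j0)}) : ∃ S1 S2, Dec i0 j0 S S1 S2 := by
  have key : ∀ i j, (i, j) ∈ S → ¬ (i = i0 ∧ j = j0) → Lft i0 j0 S i j ∨ Rgt i0 j0 S i j :=
    fun i j => lft_or_rgt hS _ i j rfl
  have disj : ∀ i j, Lft i0 j0 S i j → Rgt i0 j0 S i j → False :=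
    fun i j => lft_rgt_disj hS _ i j rfl
  have hch : (∃ i, i0 < i ∧ (i, j0) ∈ S) ∧ ∃ j, j0 < j ∧ (i0, j) ∈ S := by
    have hco := hS.co i0 j0 hS.root
    have : ∃ i j, (i, j) ∈ S ∧ ¬ (i = i0 ∧ j = j0) := by
      by_contra! hcon
      apply hne
      ext ⟨i, j⟩
      simp only [mem_singleton, Prod.mk.injEq]
      constructor
      · exact fun h => ⟨(hcon i j h).1, (hcon i j h).2⟩
      · rintro ⟨rfl, rfl⟩; exact hS.root
    obtain ⟨i, j, h1, h2⟩ := this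
    rcases key i j h1 h2 with h | h
    · exact ⟨h.exists_base, hco.1 h.exists_base⟩
    · exact ⟨hco.2 h.exists_base, h.exists_base⟩
  obtain ⟨hA, hB⟩ := hch
  refine ⟨S.filter (fun v => Lft i0 j0 S v.1 v.2), S.filter (fun v => Rgt i0 j0 S v.1 v.2), ?_⟩
  constructor
  · ext ⟨i, j⟩
    simp only [mem_insert, Prod.mk.injEq, mem_union, mem_filter]
    constructor
    · intro h
      by_cases h' : i = i0 ∧ j = j0
      · exact Or.inl h'
      · have := key i j h h'
        tauto
    · rintro (⟨rfl, rfl⟩ | h | h)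
      · exact hS.root
      · exact h.1
      · exact h.1
  · intro i j h; exact (mem_filter.1 h).2.row
  · intro i j h; exact (mem_filter.1 h).2.col
  · intro i j j' h h'
    have h1 := (mem_filter.1 h).2
    have h2 := (mem_filter.1 h').2
    simp only at h1 h2
    rcases lt_trichotomy j j' with hlt | rfl | hlt
    · exact disj _ _ (.right _ _ _ h1 hlt h2.mem) h2
    · exact disj _ _ h1 h2
    · exact disj _ _ h1 (.right _ _ _ h2 hlt h1.mem)
  · intro i i' j h h'
    have h1 := (mem_filter.1 h).2
    have h2 := (mem_filter.1 h').2
    simp only at h1 h2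
    rcases lt_trichotomy i i' with hlt | rfl | hlt
    · exact disj _ _ (.down _ _ _ h1 hlt h2.mem) h2
    · exact disj _ _ h1 h2
    · exact disj _ _ h1 (.down _ _ _ h2 hlt h1.mem)
  · have hmin : ∀ i, i0 < i → (i, j0) ∈ S → Nat.find hA ≤ i := fun i h1 h2 => Nat.find_min' hA ⟨h1, h2⟩
    have hsp := Nat.find_spec hA
    generalize Nat.find hA = i1 at hmin hsp
    refine ⟨i1, ?_, ?_, ?_, ?_⟩
    · exact mem_filter.2 ⟨hsp.2, .base _ hsp.2 hsp.1⟩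
    · intro i j h; exact Lft.le_of hmin (mem_filter.1 h).2
    · intro i j h hn
      have hl := (mem_filter.1 h).2
      simp only at hl
      have hrow := hl.row
      have hle := Lft.le_of hmin hl
      have hx := hS.na i j hl.mem (by omega)
      have e1 : (∃ i', i' < i ∧ (i', j) ∈ S) ↔
          (∃ i', i' < i ∧ (i', j) ∈ S.filter (fun v => Lft i0 j0 S v.1 v.2)) := by
        constructor
        · rintro ⟨i', h1, h2⟩
          by_cases hr : i' = i0 ∧ j = j0
          · obtain ⟨rfl, rfl⟩ := hr
            exact ⟨i1, by omega, mem_filter.2 ⟨hsp.2, .base _ hsp.2 hsp.1⟩⟩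
          · rcases key i' j h2 hr with h3 | h3
            · exact ⟨i', h1, mem_filter.2 ⟨h2, h3⟩⟩
            · exact (disj _ _ hl (.down _ _ _ h3 h1 hl.mem)).elim
        · rintro ⟨i', h1, h2⟩
          exact ⟨i', h1, (mem_filter.1 h2).1⟩
      have e2 : (∃ j', j' < j ∧ (i, j') ∈ S) ↔
          (∃ j', j' < j ∧ (i, j') ∈ S.filter (fun v => Lft i0 j0 S v.1 v.2)) := by
        constructor
        · rintro ⟨j', h1, h2⟩
          rcases key i j' h2 (by omega) with h3 | h3
          · exact ⟨j', h1, mem_filter.2 ⟨h2, h3⟩⟩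
          · exact (disj _ _ hl (.right _ _ _ h3 h1 hl.mem)).elim
        · rintro ⟨i', h1, h2⟩
          exact ⟨i', h1, (mem_filter.1 h2).1⟩
      rw [← e1, ← e2]
      exact hx
    · intro i j h
      have hl := (mem_filter.1 h).2
      simp only at hl
      have hco := hS.co i j hl.mem
      constructor
      · rintro ⟨i', h1, h2⟩
        obtain ⟨j', h3, h4⟩ := hco.1 ⟨i', h1, (mem_filter.1 h2).1⟩
        exact ⟨j', h3, mem_filter.2 ⟨h4, .right _ _ _ hl h3 h4⟩⟩
      · rintro ⟨i', h1, h2⟩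
        obtain ⟨j', h3, h4⟩ := hco.2 ⟨i', h1, (mem_filter.1 h2).1⟩
        exact ⟨j', h3, mem_filter.2 ⟨h4, .down _ _ _ hl h3 h4⟩⟩
  · have hmin : ∀ j, j0 < j → (i0, j) ∈ S → Nat.find hB ≤ j := fun i h1 h2 => Nat.find_min' hB ⟨h1, h2⟩
    have hsp := Nat.find_spec hB
    generalize Nat.find hB = j1 at hmin hsp
    refine ⟨j1, ?_, ?_, ?_, ?_⟩
    · exact mem_filter.2 ⟨hsp.2, .base _ hsp.2 hsp.1⟩
    · intro i j h; exact Rgt.le_of hmin (mem_filter.1 h).2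
    · intro i j h hn
      have hl := (mem_filter.1 h).2
      simp only at hl
      have hcol := hl.col
      have hle := Rgt.le_of hmin hl
      have hx := hS.na i j hl.mem (by omega)
      have e1 : (∃ i', i' < i ∧ (i', j) ∈ S) ↔
          (∃ i', i' < i ∧ (i', j) ∈ S.filter (fun v => Rgt i0 j0 S v.1 v.2)) := by
        constructor
        · rintro ⟨i', h1, h2⟩
          rcases key i' j h2 (by omega) with h3 | h3
          · exact (disj _ _ (.down _ _ _ h3 h1 hl.mem) hl).elim
          · exact ⟨i', h1, mem_filter.2 ⟨h2, h3⟩⟩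
        · rintro ⟨i', h1, h2⟩
          exact ⟨i', h1, (mem_filter.1 h2).1⟩
      have e2 : (∃ j', j' < j ∧ (i, j') ∈ S) ↔
          (∃ j', j' < j ∧ (i, j') ∈ S.filter (fun v => Rgt i0 j0 S v.1 v.2)) := by
        constructor
        · rintro ⟨j', h1, h2⟩
          by_cases hr : i = i0 ∧ j' = j0
          · obtain ⟨rfl, rfl⟩ := hr
            exact ⟨j1, by omega, mem_filter.2 ⟨hsp.2, .base _ hsp.2 hsp.1⟩⟩
          · rcases key i j' h2 hr with h3 | h3
            · exact (disj _ _ (.right _ _ _ h3 h1 hl.mem) hl).elim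
            · exact ⟨j', h1, mem_filter.2 ⟨h2, h3⟩⟩
        · rintro ⟨i', h1, h2⟩
          exact ⟨i', h1, (mem_filter.1 h2).1⟩
      rw [← e1, ← e2]
      exact hx
    · intro i j h
      have hl := (mem_filter.1 h).2
      simp only at hl
      have hco := hS.co i j hl.mem
      constructor
      · rintro ⟨i', h1, h2⟩
        obtain ⟨j', h3, h4⟩ := hco.1 ⟨i', h1, (mem_filter.1 h2).1⟩
        exact ⟨j', h3, mem_filter.2 ⟨h4, .right _ _ _ hl h3 h4⟩⟩
      · rintro ⟨i', h1, h2⟩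
        obtain ⟨j', h3, h4⟩ := hco.2 ⟨i', h1, (mem_filter.1 h2).1⟩
        exact ⟨j', h3, mem_filter.2 ⟨h4, .down _ _ _ hl h3 h4⟩⟩

lemma Dec.mem_iff {S1 S2 : Finset (ℕ × ℕ)} (h : Dec i0 j0 S S1 S2) (i j : ℕ) :
    (i, j) ∈ S ↔ (i = i0 ∧ j = j0) ∨ (i, j) ∈ S1 ∨ (i, j) ∈ S2 := by
  rw [h.eq]; simp

lemma Dec.isC {S1 S2 : Finset (ℕ × ℕ)} (h : Dec i0 j0 S S1 S2) : IsC i0 j0 S := by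
  obtain ⟨i1, h1⟩ := h.c1
  obtain ⟨j1, h2⟩ := h.c2
  have hm := h.mem_iff
  have r1 := h.row1
  have r2 := h.col2
  have hr := h.rows
  have hc := h.cols
  have hi1 := r1 _ _ h1.root
  have hj1 := r2 _ _ h2.root
  constructor
  · rw [hm]; simp
  · intro i j hij
    rcases (hm i j).1 hij with h3 | h3 | h3
    · omega
    · have := h1.le _ _ h3; omega
    · have := h2.le _ _ h3; omega
  · intro i j hij hne
    rcases (hm i j).1 hij with h3 | h3 | h3
    · exact absurd h3 hne
    · have hlt := r1 _ _ h3
      have hle := h1.le _ _ h3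
      have e2 : (∃ j', j' < j ∧ (i, j') ∈ S) ↔ (∃ j', j' < j ∧ (i, j') ∈ S1) := by
        refine exists_congr fun j' => and_congr_right fun _ => ?_
        rw [hm]
        constructor
        · rintro (h4 | h4 | h4)
          · omega
          · exact h4
          · exact (hr _ _ _ h3 h4).elim
        · exact fun h4 => Or.inr (Or.inl h4)
      by_cases hroot : i = i1 ∧ j = j0
      · obtain ⟨rfl, rfl⟩ := hroot
        refine Or.inl ⟨⟨i0, hlt, (hm _ _).2 (Or.inl ⟨rfl, rfl⟩)⟩, ?_⟩
        rw [e2]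
        rintro ⟨j', h4, h5⟩
        have := h1.le _ _ h5
        omega
      · have hx := h1.na i j h3 hroot
        have e1 : (∃ i', i' < i ∧ (i', j) ∈ S) ↔ (∃ i', i' < i ∧ (i', j) ∈ S1) := by
          constructor
          · rintro ⟨i', h4, h5⟩
            rcases (hm _ _).1 h5 with h6 | h6 | h6
            · obtain ⟨rfl, rfl⟩ := h6
              exact ⟨i1, by omega, h1.root⟩
            · exact ⟨i', h4, h6⟩
            · exact (hc _ _ _ h3 h6).elim
          · rintro ⟨i', h4, h5⟩
            exact ⟨i', h4, (hm _ _).2 (Or.inr (Or.inl h5))⟩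
        rw [e1, e2]; exact hx
    · have hlt := r2 _ _ h3
      have hle := h2.le _ _ h3
      have e1 : (∃ i', i' < i ∧ (i', j) ∈ S) ↔ (∃ i', i' < i ∧ (i', j) ∈ S2) := by
        refine exists_congr fun j' => and_congr_right fun _ => ?_
        rw [hm]
        constructor
        · rintro (h4 | h4 | h4)
          · omega
          · exact (hc _ _ _ h4 h3).elim
          · exact h4
        · exact fun h4 => Or.inr (Or.inr h4)
      by_cases hroot : i = i0 ∧ j = j1
      · obtain ⟨rfl, rfl⟩ := hroot
        refine Or.inr ⟨⟨j0, hlt, (hm _ _).2 (Or.inl ⟨rfl, rfl⟩)⟩, ?_⟩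
        rw [e1]
        rintro ⟨j', h4, h5⟩
        have := h2.le _ _ h5
        omega
      · have hx := h2.na i j h3 hroot
        have e2 : (∃ j', j' < j ∧ (i, j') ∈ S) ↔ (∃ j', j' < j ∧ (i, j') ∈ S2) := by
          constructor
          · rintro ⟨i', h4, h5⟩
            rcases (hm _ _).1 h5 with h6 | h6 | h6
            · obtain ⟨rfl, rfl⟩ := h6
              exact ⟨j1, by omega, h2.root⟩
            · exact (hr _ _ _ h6 h3).elim
            · exact ⟨i', h4, h6⟩
          · rintro ⟨i', h4, h5⟩
            exact ⟨i', h4, (hm _ _).2 (Or.inr (Or.inr h5))⟩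
        rw [e1, e2]; exact hx
  · intro i j hij
    rcases (hm i j).1 hij with h3 | h3 | h3
    · obtain ⟨rfl, rfl⟩ := h3
      exact ⟨fun _ => ⟨j1, hj1, (hm _ _).2 (Or.inr (Or.inr h2.root))⟩,
        fun _ => ⟨i1, hi1, (hm _ _).2 (Or.inr (Or.inl h1.root))⟩⟩
    · have := h1.co i j h3
      have hle := h1.le _ _ h3
      have hlt := r1 _ _ h3
      convert this using 1
      · refine (exists_congr fun i' => and_congr_right fun _ => ?_)
        rw [hm]
        constructor
        · rintro (h4 | h4 | h4)
          · omega
          · exact h4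
          · exact (hc _ _ _ h3 h4).elim
        · exact fun h4 => Or.inr (Or.inl h4)
      · refine (exists_congr fun i' => and_congr_right fun _ => ?_)
        rw [hm]
        constructor
        · rintro (h4 | h4 | h4)
          · omega
          · exact h4
          · exact (hr _ _ _ h3 h4).elim
        · exact fun h4 => Or.inr (Or.inl h4)
    · have := h2.co i j h3
      have hle := h2.le _ _ h3
      have hlt := r2 _ _ h3
      convert this using 1
      · refine (exists_congr fun i' => and_congr_right fun _ => ?_)
        rw [hm]
        constructor
        · rintro (h4 | h4 | h4)
          · omega
          · exact (hc _ _ _ h4 h3).elim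
          · exact h4
        · exact fun h4 => Or.inr (Or.inr h4)
      · refine (exists_congr fun i' => and_congr_right fun _ => ?_)
        rw [hm]
        constructor
        · rintro (h4 | h4 | h4)
          · omega
          · exact (hr _ _ _ h4 h3).elim
          · exact h4
        · exact fun h4 => Or.inr (Or.inr h4)

lemma Dec.side {S1 S2 T1 T2 : Finset (ℕ × ℕ)} (h : Dec i0 j0 S S1 S2) (h' : Dec i0 j0 S T1 T2) :
    ∀ m i j : ℕ, i + j = m → ((i, j) ∈ S1 → (i, j) ∈ T1) ∧ ((i, j) ∈ S2 → (i, j) ∈ T2) := by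
  have hS := h.isC
  have hm := h.mem_iff
  have hm' := h'.mem_iff
  intro m
  induction m using Nat.strong_induction_on with
  | _ m ih =>
    intro i j hij
    constructor
    · intro h1
      have hlt := h.row1 _ _ h1
      have hmem := (hm i j).2 (Or.inr (Or.inl h1))
      rcases (hm' i j).1 hmem with h2 | h2 | h2
      · omega
      · exact h2
      · exfalso
        have hlt2 := h'.col2 _ _ h2
        rcases xor_or' (hS.na i j hmem (by omega)) with ⟨i', h3, h4⟩ | ⟨j', h3, h4⟩
        · rcases (hm _ _).1 h4 with h5 | h5 | h5
          · omega
          · exact h'.cols _ _ _ ((ih (i' + j) (by omega) i' j rfl).1 h5) h2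
          · exact h.cols _ _ _ h1 h5
        · rcases (hm _ _).1 h4 with h5 | h5 | h5
          · omega
          · exact h'.rows _ _ _ ((ih (i + j') (by omega) i j' rfl).1 h5) h2
          · exact h.rows _ _ _ h1 h5
    · intro h1
      have hlt := h.col2 _ _ h1
      have hmem := (hm i j).2 (Or.inr (Or.inr h1))
      rcases (hm' i j).1 hmem with h2 | h2 | h2
      · omega
      · exfalso
        have hlt2 := h'.row1 _ _ h2
        rcases xor_or' (hS.na i j hmem (by omega)) with ⟨i', h3, h4⟩ | ⟨j', h3, h4⟩
        · rcases (hm _ _).1 h4 with h5 | h5 | h5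
          · omega
          · exact h.cols _ _ _ h5 h1
          · exact h'.cols _ _ _ h2 ((ih (i' + j) (by omega) i' j rfl).2 h5)
        · rcases (hm _ _).1 h4 with h5 | h5 | h5
          · omega
          · exact h.rows _ _ _ h5 h1
          · exact h'.rows _ _ _ h2 ((ih (i + j') (by omega) i j' rfl).2 h5)
      · exact h2

lemma Dec.unique {S1 S2 T1 T2 : Finset (ℕ × ℕ)} (h : Dec i0 j0 S S1 S2)
    (h' : Dec i0 j0 S T1 T2) : S1 = T1 ∧ S2 = T2 := by
  constructor
  · ext ⟨i, j⟩
    exact ⟨(h.side h' _ i j rfl).1, (h'.side h _ i j rfl).1⟩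
  · ext ⟨i, j⟩
    exact ⟨(h.side h' _ i j rfl).2, (h'.side h _ i j rfl).2⟩

end

/-- one pair of the row/column weight -/
def rw1 (q : ℤ) (x y : ℕ) : ℤ := if y < x then q else 1

def WW (q : ℤ) (A B : Finset ℕ) : ℤ := ∏ x ∈ A, ∏ y ∈ B, rw1 q x y

def cw (q : ℤ) (u v : ℕ × ℕ) : ℤ := if u.1 < v.1 ∧ v.2 < u.2 then q else 1

def leaf (S : Finset (ℕ × ℕ)) : Finset (ℕ × ℕ) :=
  S.filter (fun v => ∀ w ∈ S, w.1 = v.1 → w.2 ≤ v.2)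

def wt (q : ℤ) (S : Finset (ℕ × ℕ)) : ℤ := ∏ u ∈ leaf S, ∏ v ∈ leaf S, cw q u v

open Classical in
noncomputable def cls (I J : Finset ℕ) : Finset (Finset (ℕ × ℕ)) :=
  (I ×ˢ J).powerset.filter
    (fun S => S.image Prod.fst = I ∧ S.image Prod.snd = J ∧ ∃ i0 j0, IsC i0 j0 S)

noncomputable def FF (q : ℤ) (I J : Finset ℕ) : ℤ := ∑ S ∈ cls I J, wt q S

lemma mem_cls {I J : Finset ℕ} {S : Finset (ℕ × ℕ)} :
    S ∈ cls I J ↔ S.image Prod.fst = I ∧ S.image Prod.snd = J ∧ ∃ i0 j0, IsC i0 j0 S := by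
  classical
  unfold cls
  rw [mem_filter, mem_powerset]
  constructor
  · exact fun h => h.2
  · intro h
    refine ⟨?_, h⟩
    intro v hv
    rw [mem_product, ← h.1, ← h.2.1]
    exact ⟨mem_image_of_mem _ hv, mem_image_of_mem _ hv⟩

lemma mem_leaf {S : Finset (ℕ × ℕ)} {i j : ℕ} :
    (i, j) ∈ leaf S ↔ (i, j) ∈ S ∧ ∀ j', (i, j') ∈ S → j' ≤ j := by
  unfold leaf
  rw [mem_filter]
  constructor
  · exact fun h => ⟨h.1, fun j' h' => h.2 _ h' rfl⟩
  · rintro ⟨h1, h2⟩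
    refine ⟨h1, ?_⟩
    rintro ⟨a, b⟩ h3 h4
    simp only at h4
    subst h4
    exact h2 _ h3

lemma IsC.mem_leaf {i0 j0 : ℕ} {S : Finset (ℕ × ℕ)} (hS : IsC i0 j0 S) {i j : ℕ} :
    (i, j) ∈ leaf S ↔ (i, j) ∈ S ∧ ∀ i', (i', j) ∈ S → i' ≤ i := by
  rw [CN.mem_leaf]
  refine and_congr_right fun h => ?_
  have := hS.co i j h
  constructor
  · intro h1 i' h2
    by_contra! h3
    obtain ⟨j', h4, h5⟩ := this.1 ⟨i', h3, h2⟩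
    have := h1 _ h5
    omega
  · intro h1 i' h2
    by_contra! h3
    obtain ⟨j', h4, h5⟩ := this.2 ⟨i', h3, h2⟩
    have := h1 _ h5
    omega

lemma leaf_fst_injOn (S : Finset (ℕ × ℕ)) : Set.InjOn Prod.fst (leaf S : Set (ℕ × ℕ)) := by
  rintro ⟨a, b⟩ h ⟨a', b'⟩ h' hh
  simp only at hh
  subst hh
  rw [mem_coe, mem_leaf] at h h'
  have := h.2 _ h'.1
  have := h'.2 _ h.1
  ext <;> simp; omega

lemma IsC.leaf_snd_injOn {i0 j0 : ℕ} {S : Finset (ℕ × ℕ)} (hS : IsC i0 j0 S) :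
    Set.InjOn Prod.snd (leaf S : Set (ℕ × ℕ)) := by
  rintro ⟨a, b⟩ h ⟨a', b'⟩ h' hh
  simp only at hh
  subst hh
  rw [mem_coe, hS.mem_leaf] at h h'
  have := h.2 _ h'.1
  have := h'.2 _ h.1
  ext <;> simp; omega

lemma leaf_image_fst (S : Finset (ℕ × ℕ)) : (leaf S).image Prod.fst = S.image Prod.fst := by
  apply subset_antisymm
  · exact image_subset_image (filter_subset _ _)
  · intro i hi
    rw [mem_image] at hi
    obtain ⟨⟨i, j⟩, h1, rfl⟩ := hi
    have hne : (S.filter (fun v => v.1 = i)).Nonempty := ⟨(i, j), by simp [h1]⟩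
    obtain ⟨⟨a, b⟩, h2, h3⟩ := exists_max_image _ Prod.snd hne
    rw [mem_filter] at h2
    obtain ⟨h2, rfl⟩ := h2
    refine mem_image.2 ⟨(a, b), mem_leaf.2 ⟨h2, fun j' h => ?_⟩, rfl⟩
    exact h3 (a, j') (by simp [h])

lemma IsC.leaf_image_snd {i0 j0 : ℕ} {S : Finset (ℕ × ℕ)} (hS : IsC i0 j0 S) :
    (leaf S).image Prod.snd = S.image Prod.snd := by
  apply subset_antisymm
  · exact image_subset_image (filter_subset _ _)
  · intro i hi
    rw [mem_image] at hi
    obtain ⟨⟨i, j⟩, h1, rfl⟩ := hi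
    have hne : (S.filter (fun v => v.2 = j)).Nonempty := ⟨(i, j), by simp [h1]⟩
    obtain ⟨⟨a, b⟩, h2, h3⟩ := exists_max_image _ Prod.fst hne
    rw [mem_filter] at h2
    obtain ⟨h2, rfl⟩ := h2
    refine mem_image.2 ⟨(a, b), hS.mem_leaf.2 ⟨h2, fun j' h => ?_⟩, rfl⟩
    exact h3 (j', b) (by simp [h])

section
variable {i0 j0 : ℕ} {S S1 S2 : Finset (ℕ × ℕ)}

lemma Dec.leaf (h : Dec i0 j0 S S1 S2) : leaf S = leaf S1 ∪ leaf S2 := by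
  have hm := h.mem_iff
  obtain ⟨i1, h1⟩ := h.c1
  obtain ⟨j1, h2⟩ := h.c2
  have hr := h.rows
  have hj1 := h.col2 _ _ h2.root
  ext ⟨i, j⟩
  rw [mem_union, mem_leaf, mem_leaf, mem_leaf]
  constructor
  · rintro ⟨h3, h4⟩
    rcases (hm _ _).1 h3 with h5 | h5 | h5
    · obtain ⟨rfl, rfl⟩ := h5
      have := h4 j1 ((hm _ _).2 (Or.inr (Or.inr h2.root)))
      omega
    · exact Or.inl ⟨h5, fun j' h => h4 _ ((hm _ _).2 (Or.inr (Or.inl h)))⟩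
    · exact Or.inr ⟨h5, fun j' h => h4 _ ((hm _ _).2 (Or.inr (Or.inr h)))⟩
  · rintro (⟨h3, h4⟩ | ⟨h3, h4⟩)
    · refine ⟨(hm _ _).2 (Or.inr (Or.inl h3)), fun j' h6 => ?_⟩
      rcases (hm _ _).1 h6 with h5 | h5 | h5
      · have := h.row1 _ _ h3; omega
      · exact h4 _ h5
      · exact (hr _ _ _ h3 h5).elim
    · refine ⟨(hm _ _).2 (Or.inr (Or.inr h3)), fun j' h6 => ?_⟩
      rcases (hm _ _).1 h6 with h5 | h5 | h5
      · have := h.col2 _ _ h3; omega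
      · exact (hr _ _ _ h5 h3).elim
      · exact h4 _ h5

lemma cw_cross {q : ℤ} (hq : q * q = 1) (u v : ℕ × ℕ) (h1 : u.1 ≠ v.1) (h2 : u.2 ≠ v.2) :
    cw q u v * cw q v u = rw1 q u.1 v.1 * rw1 q u.2 v.2 := by
  unfold cw rw1
  rcases lt_or_gt_of_ne h1 with h | h <;> rcases lt_or_gt_of_ne h2 with h' | h' <;>
    simp [h, h', h.not_gt, h'.not_gt, hq]

lemma Dec.wt {q : ℤ} (hq : q * q = 1) (h : Dec i0 j0 S S1 S2) :
    wt q S = wt q S1 * wt q S2 * (WW q (S1.image Prod.fst) (S2.image Prod.fst) *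
      WW q (S1.image Prod.snd) (S2.image Prod.snd)) := by
  have hd : Disjoint (CN.leaf S1) (CN.leaf S2) := by
    rw [disjoint_left]
    rintro ⟨i, j⟩ h1 h2
    exact h.rows _ _ _ (mem_leaf.1 h1).1 (mem_leaf.1 h2).1
  obtain ⟨i1, h1⟩ := h.c1
  obtain ⟨j1, h2⟩ := h.c2
  have hcross : (∏ u ∈ CN.leaf S1, ∏ v ∈ CN.leaf S2, cw q u v) *
      (∏ u ∈ CN.leaf S2, ∏ v ∈ CN.leaf S1, cw q u v) =
      WW q (S1.image Prod.fst) (S2.image Prod.fst) *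
      WW q (S1.image Prod.snd) (S2.image Prod.snd) := by
    rw [prod_comm (s := CN.leaf S2), ← prod_mul_distrib, ← leaf_image_fst S1, ← leaf_image_fst S2,
      ← h1.leaf_image_snd, ← h2.leaf_image_snd]
    unfold WW
    rw [prod_image (leaf_fst_injOn S1), prod_image h1.leaf_snd_injOn, ← prod_mul_distrib]
    refine prod_congr rfl fun u hu => ?_
    rw [prod_image (leaf_fst_injOn S2), prod_image h2.leaf_snd_injOn, ← prod_mul_distrib,
      ← prod_mul_distrib]
    refine prod_congr rfl fun v hv => ?_
    obtain ⟨a, b⟩ := u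
    obtain ⟨c, d⟩ := v
    have hu' := (mem_leaf.1 hu).1
    have hv' := (mem_leaf.1 hv).1
    apply cw_cross hq
    · rintro heq
      simp only at heq
      subst heq
      exact h.rows _ _ _ hu' hv'
    · rintro heq
      simp only at heq
      subst heq
      exact h.cols _ _ _ hu' hv'
  rw [← hcross]
  unfold CN.wt
  rw [h.leaf, prod_union hd]
  simp only [prod_union hd, prod_mul_distrib]
  ring

end

lemma IsC.root_row {i1 j1 i0 : ℕ} {X : Finset ℕ} {S : Finset (ℕ × ℕ)} (h : IsC i1 j1 S)
    (hI : S.image Prod.fst = insert i0 X) (hX : ∀ x ∈ X, i0 < x) : i1 = i0 := by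
  have h1 : i1 ∈ insert i0 X := hI ▸ mem_image_of_mem Prod.fst h.root
  have h2 : i0 ∈ S.image Prod.fst := by rw [hI]; exact mem_insert_self _ _
  obtain ⟨⟨a, b⟩, h3, rfl⟩ := mem_image.1 h2
  have := (h.le _ _ h3).1
  rcases mem_insert.1 h1 with h4 | h4
  · exact h4
  · have := hX _ h4
    simp only at *
    omega

lemma IsC.root_col {i1 j1 j0 : ℕ} {X : Finset ℕ} {S : Finset (ℕ × ℕ)} (h : IsC i1 j1 S)
    (hI : S.image Prod.snd = insert j0 X) (hX : ∀ x ∈ X, j0 < x) : j1 = j0 := by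
  have h1 : j1 ∈ insert j0 X := hI ▸ mem_image_of_mem Prod.snd h.root
  have h2 : j0 ∈ S.image Prod.snd := by rw [hI]; exact mem_insert_self _ _
  obtain ⟨⟨a, b⟩, h3, rfl⟩ := mem_image.1 h2
  have := (h.le _ _ h3).2
  rcases mem_insert.1 h1 with h4 | h4
  · exact h4
  · have := hX _ h4
    simp only at *
    omega

lemma WW_insert_right {q : ℤ} {i0 : ℕ} {A B : Finset ℕ} (hA : ∀ x ∈ A, i0 < x) (hB : i0 ∉ B) :
    WW q A (insert i0 B) = q ^ #A * WW q A B := by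
  unfold WW
  rw [← prod_const, ← prod_mul_distrib]
  refine prod_congr rfl fun x hx => ?_
  rw [prod_insert hB]
  simp [rw1, hA x hx]

lemma WW_insert_left {q : ℤ} {j0 : ℕ} {A B : Finset ℕ} (hA : j0 ∉ A) (hB : ∀ x ∈ B, j0 < x) :
    WW q (insert j0 A) B = WW q A B := by
  unfold WW
  rw [prod_insert hA, prod_eq_one, one_mul]
  intro x hx
  simp [rw1, (hB x hx).not_gt]

lemma build_dec {i0 j0 : ℕ} {X Y A K : Finset ℕ} {S1 S2 : Finset (ℕ × ℕ)}
    (hX : ∀ x ∈ X, i0 < x) (hY : ∀ y ∈ Y, j0 < y) (hA : A ⊆ X) (hK : K ⊆ Y)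
    (h1 : S1 ∈ cls A (insert j0 K)) (h2 : S2 ∈ cls (insert i0 (X \ A)) (Y \ K)) :
    Dec i0 j0 (insert (i0, j0) (S1 ∪ S2)) S1 S2 := by
  rw [mem_cls] at h1 h2
  obtain ⟨r1, c1, a1, b1, hC1⟩ := h1
  obtain ⟨r2, c2, a2, b2, hC2⟩ := h2
  have e1 := hC1.root_col c1 (fun x hx => hY _ (hK hx))
  have e2 := hC2.root_row r2 (fun x hx => hX _ (mem_sdiff.1 hx).1)
  subst e1 e2
  have m1 : ∀ i j, (i, j) ∈ S1 → i ∈ A := fun i j h => r1 ▸ mem_image_of_mem Prod.fst h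
  have m2 : ∀ i j, (i, j) ∈ S1 → j ∈ insert b1 K := fun i j h => c1 ▸ mem_image_of_mem Prod.snd h
  have m3 : ∀ i j, (i, j) ∈ S2 → i ∈ insert a2 (X \ A) :=
    fun i j h => r2 ▸ mem_image_of_mem Prod.fst h
  have m4 : ∀ i j, (i, j) ∈ S2 → j ∈ Y \ K := fun i j h => c2 ▸ mem_image_of_mem Prod.snd h
  refine ⟨rfl, ?_, ?_, ?_, ?_, ⟨_, hC1⟩, ⟨_, hC2⟩⟩
  · intro i j h; exact hX _ (hA (m1 _ _ h))
  · intro i j h; exact hY _ (mem_sdiff.1 (m4 _ _ h)).1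
  · intro i j j' h h'
    have n1 := m1 _ _ h
    have n2 := m3 _ _ h'
    rw [mem_insert, mem_sdiff] at n2
    rcases n2 with rfl | n2
    · exact lt_irrefl _ (hX _ (hA n1))
    · exact n2.2 n1
  · intro i i' j h h'
    have n1 := m2 _ _ h
    have n2 := m4 _ _ h'
    rw [mem_sdiff] at n2
    rw [mem_insert] at n1
    rcases n1 with rfl | n1
    · exact lt_irrefl _ (hY _ n2.1)
    · exact n2.2 n1

lemma FF_rec {q : ℤ} (hq : q * q = 1) {i0 j0 : ℕ} {X Y : Finset ℕ}
    (hX : ∀ x ∈ X, i0 < x) (hY : ∀ y ∈ Y, j0 < y) (hne : ¬ (X = ∅ ∧ Y = ∅)) :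
    FF q (insert i0 X) (insert j0 Y) = ∑ A ∈ X.powerset, ∑ K ∈ Y.powerset,
      (q ^ #A * WW q A (X \ A) * WW q K (Y \ K)) *
        (FF q A (insert j0 K) * FF q (insert i0 (X \ A)) (Y \ K)) := by
  have hi0 : i0 ∉ X := fun h => lt_irrefl _ (hX _ h)
  have hj0 : j0 ∉ Y := fun h => lt_irrefl _ (hY _ h)
  have step : ∀ A ∈ X.powerset, ∀ K ∈ Y.powerset,
      (q ^ #A * WW q A (X \ A) * WW q K (Y \ K)) *
        (FF q A (insert j0 K) * FF q (insert i0 (X \ A)) (Y \ K)) =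
      ∑ p ∈ cls A (insert j0 K) ×ˢ cls (insert i0 (X \ A)) (Y \ K),
        wt q (insert (i0, j0) (p.1 ∪ p.2)) := by
    intro A hA K hK
    rw [mem_powerset] at hA hK
    unfold FF
    rw [sum_mul_sum, sum_product, mul_sum]
    refine sum_congr rfl fun S1 h1 => ?_
    rw [mul_sum]
    refine sum_congr rfl fun S2 h2 => ?_
    rw [(build_dec hX hY hA hK h1 h2).wt hq]
    rw [mem_cls] at h1 h2
    rw [h1.1, h1.2.1, h2.1, h2.2.1, WW_insert_right (fun x hx => hX x (hA hx)) (by simp [hi0]),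
      WW_insert_left (fun h => hj0 (hK h)) (fun x hx => hY x (mem_sdiff.1 hx).1)]
    ring
  rw [sum_congr rfl fun A hA => sum_congr rfl fun K hK => step A hA K hK]
  rw [← sum_product' (f := fun A K => ∑ p ∈ cls A (insert j0 K) ×ˢ cls (insert i0 (X \ A)) (Y \ K),
        wt q (insert (i0, j0) (p.1 ∪ p.2))), sum_sigma']
  symm
  unfold FF
  refine sum_bij (fun x _ => insert (i0, j0) (x.2.1 ∪ x.2.2)) ?_ ?_ ?_ ?_
  · rintro ⟨⟨A, K⟩, ⟨S1, S2⟩⟩ hx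
    simp only [mem_sigma, mem_product, mem_powerset] at hx
    obtain ⟨⟨hA, hK⟩, h1, h2⟩ := hx
    have hd := build_dec hX hY hA hK h1 h2
    simp only
    rw [mem_cls] at h1 h2 ⊢
    refine ⟨?_, ?_, _, _, hd.isC⟩
    · rw [image_insert, image_union, h1.1, h2.1]
      ext x
      simp only [mem_insert, mem_union, mem_sdiff]
      have := @hA x
      tauto
    · rw [image_insert, image_union, h1.2.1, h2.2.1]
      ext x
      simp only [mem_insert, mem_union, mem_sdiff]
      have := @hK x
      tauto
  · rintro ⟨⟨A, K⟩, ⟨S1, S2⟩⟩ hx ⟨⟨A', K'⟩, ⟨T1, T2⟩⟩ hx' heq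
    simp only [mem_sigma, mem_product, mem_powerset] at hx hx' heq
    obtain ⟨⟨hA, hK⟩, h1, h2⟩ := hx
    obtain ⟨⟨hA', hK'⟩, h1', h2'⟩ := hx'
    have hd := build_dec hX hY hA hK h1 h2
    have hd' := build_dec hX hY hA' hK' h1' h2'
    rw [← heq] at hd'
    obtain ⟨rfl, rfl⟩ := hd.unique hd'
    rw [mem_cls] at h1 h1'
    have eA : A = A' := h1.1.symm.trans h1'.1
    have eK : K = K' := by
      have e := h1.2.1.symm.trans h1'.2.1
      rw [← erase_insert (fun h => hj0 (hK h)), e, erase_insert (fun h => hj0 (hK' h))]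
    subst eA eK
    rfl
  · intro S hS
    rw [mem_cls] at hS
    obtain ⟨hr, hc, a, b, hC⟩ := hS
    obtain rfl := hC.root_row hr hX
    obtain rfl := hC.root_col hc hY
    have hS1 : S ≠ {(a, b)} := by
      rintro rfl
      apply hne
      rw [image_singleton] at hr hc
      constructor
      · have : X ⊆ {a} := by
          have : X ⊆ insert a X := subset_insert _ _
          rwa [← hr] at this
        rw [eq_empty_iff_forall_notMem]
        intro x hx
        have h1 := mem_singleton.1 (this hx)
        exact hi0 (h1 ▸ hx)
      · have : Y ⊆ {b} := by
          have : Y ⊆ insert b Y := subset_insert _ _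
          rwa [← hc] at this
        rw [eq_empty_iff_forall_notMem]
        intro x hx
        have h1 := mem_singleton.1 (this hx)
        exact hj0 (h1 ▸ hx)
    obtain ⟨S1, S2, hd⟩ := exists_dec hC hS1
    obtain ⟨i1, hc1⟩ := hd.c1
    obtain ⟨j1, hc2⟩ := hd.c2
    have hm := hd.mem_iff
    have hrm : ∀ i, (i = a ∨ i ∈ X) ↔ ∃ j, (i, j) ∈ S := by
      intro i
      rw [← mem_insert, ← hr]
      simp
    have hcm : ∀ j, (j = b ∨ j ∈ Y) ↔ ∃ i, (i, j) ∈ S := by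
      intro i
      rw [← mem_insert, ← hc]
      simp
    refine ⟨⟨(S1.image Prod.fst, (S1.image Prod.snd).erase b), (S1, S2)⟩, ?_, hd.eq.symm⟩
    simp only [mem_sigma, mem_product, mem_powerset]
    refine ⟨⟨?_, ?_⟩, ?_, ?_⟩
    · intro x hx
      obtain ⟨⟨i, j⟩, h1, rfl⟩ := mem_image.1 hx
      have h2 := hd.row1 _ _ h1
      rcases (hrm i).2 ⟨j, (hm _ _).2 (Or.inr (Or.inl h1))⟩ with h3 | h3
      · omega
      · exact h3
    · intro x hx
      obtain ⟨h0, hx⟩ := mem_erase.1 hx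
      obtain ⟨⟨i, j⟩, h1, rfl⟩ := mem_image.1 hx
      rcases (hcm j).2 ⟨i, (hm _ _).2 (Or.inr (Or.inl h1))⟩ with h3 | h3
      · exact absurd h3 h0
      · exact h3
    · rw [mem_cls]
      refine ⟨rfl, ?_, _, _, hc1⟩
      rw [insert_erase]
      exact mem_image_of_mem Prod.snd hc1.root
    · rw [mem_cls]
      refine ⟨?_, ?_, _, _, hc2⟩
      · ext i
        rw [mem_insert, mem_sdiff]
        constructor
        · intro hx
          obtain ⟨⟨i, j⟩, h1, rfl⟩ := mem_image.1 hx
          rcases (hrm i).2 ⟨j, (hm _ _).2 (Or.inr (Or.inr h1))⟩ with h3 | h3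
          · exact Or.inl h3
          · refine Or.inr ⟨h3, fun h4 => ?_⟩
            obtain ⟨⟨i', j'⟩, h5, h6⟩ := mem_image.1 h4
            simp only at h6
            subst h6
            exact hd.rows _ _ _ h5 h1
        · rintro (rfl | ⟨h1, h2⟩)
          · exact mem_image_of_mem Prod.fst hc2.root
          · obtain ⟨j, hj⟩ := (hrm i).1 (Or.inr h1)
            rcases (hm _ _).1 hj with h3 | h3 | h3
            · exact absurd (h3.1 ▸ h1) hi0
            · exact absurd (mem_image_of_mem Prod.fst h3) h2
            · exact mem_image_of_mem Prod.fst h3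
      · ext j
        rw [mem_sdiff]
        constructor
        · intro hx
          obtain ⟨⟨i, j⟩, h1, rfl⟩ := mem_image.1 hx
          have h0 := hd.col2 _ _ h1
          rcases (hcm j).2 ⟨i, (hm _ _).2 (Or.inr (Or.inr h1))⟩ with h3 | h3
          · omega
          · refine ⟨h3, fun h4 => ?_⟩
            obtain ⟨⟨i', j'⟩, h5, h6⟩ := mem_image.1 (mem_erase.1 h4).2
            simp only at h6
            subst h6
            exact hd.cols _ _ _ h5 h1
        · rintro ⟨h1, h2⟩
          obtain ⟨i, hj⟩ := (hcm j).1 (Or.inr h1)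
          rcases (hm _ _).1 hj with h3 | h3 | h3
          · exact absurd (h3.2 ▸ h1) hj0
          · refine absurd (mem_erase.2 ⟨?_, mem_image_of_mem Prod.snd h3⟩) h2
            rintro rfl
            exact hj0 h1
          · exact mem_image_of_mem Prod.snd h3
  · intros; rfl

/-- Gaussian binomial coefficient at `q`. -/
def gg (q : ℤ) : ℕ → ℕ → ℤ
  | _, 0 => 1
  | 0, _ + 1 => 0
  | n + 1, a + 1 => q ^ (n - a) * gg q n a + gg q n (a + 1)

lemma WW_max_right {q : ℤ} {m : ℕ} {A B : Finset ℕ} (hA : ∀ x ∈ A, x < m) (hB : m ∉ B) :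
    WW q A (insert m B) = WW q A B := by
  unfold WW
  refine prod_congr rfl fun x hx => ?_
  rw [prod_insert hB]
  simp [rw1, (hA x hx).not_gt]

lemma WW_max_left {q : ℤ} {m : ℕ} {A B : Finset ℕ} (hA : m ∉ A) (hB : ∀ x ∈ B, x < m) :
    WW q (insert m A) B = q ^ #B * WW q A B := by
  unfold WW
  rw [prod_insert hA, ← prod_const]
  congr 1
  refine prod_congr rfl fun x hx => ?_
  simp [rw1, hB x hx]

lemma sum_WW (q : ℤ) (X : Finset ℕ) : ∀ a, ∑ A ∈ powersetCard a X, WW q A (X \ A) = gg q #X a := by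
  induction X using Finset.induction_on_max with
  | empty =>
    intro a
    cases a with
    | zero => simp [WW, gg]
    | succ a => rw [powersetCard_eq_empty.2 (by simp)]; simp [gg]
  | insert m X hm ih =>
    have hmX : m ∉ X := fun h => lt_irrefl _ (hm _ h)
    intro a
    cases a with
    | zero => simp [WW, gg]
    | succ a =>
      have hdisj : Disjoint (powersetCard (a + 1) X) ((powersetCard a X).image (insert m)) := by
        rw [disjoint_left]
        intro A h1 h2
        obtain ⟨B, _, rfl⟩ := mem_image.1 h2
        exact hmX ((mem_powersetCard.1 h1).1 (mem_insert_self _ _))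
      rw [powersetCard_succ_insert hmX, sum_union hdisj, card_insert_of_notMem hmX, gg, add_comm,
        ← ih, ← ih, mul_sum]
      congr 1
      · rw [sum_image]
        · refine sum_congr rfl fun A hA => ?_
          obtain ⟨h1, h2⟩ := mem_powersetCard.1 hA
          have hmA : m ∉ A := fun h => hmX (h1 h)
          have e : insert m X \ insert m A = X \ A := by
            ext x
            simp only [mem_sdiff, mem_insert]
            constructor
            · tauto
            · rintro ⟨h3, h4⟩
              have : x ≠ m := fun h => hmX (h ▸ h3)
              tauto
          rw [e, WW_max_left hmA (fun x hx => hm x (mem_sdiff.1 hx).1), card_sdiff_of_subset h1, h2]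
        · intro A hA B hB h
          have hmA : m ∉ A := fun h => hmX ((mem_powersetCard.1 hA).1 h)
          have hmB : m ∉ B := fun h => hmX ((mem_powersetCard.1 hB).1 h)
          rw [← erase_insert hmA, h, erase_insert hmB]
      · refine sum_congr rfl fun A hA => ?_
        obtain ⟨h1, h2⟩ := mem_powersetCard.1 hA
        have hmA : m ∉ A := fun h => hmX (h1 h)
        rw [insert_sdiff_of_notMem _ hmA, WW_max_right (fun x hx => hm x (h1 hx)) (by simp [hmX])]

def ff (q : ℤ) : ℕ → ℤ
  | 0 => 0
  | 1 => 1
  | m + 2 => ∑ b : Fin (m + 1), q ^ (b.1 + 1) * gg q (m + 1) (b.1 + 1) * gg q (m + 1) b.1 *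
      (ff q (b.1 + 1) * ff q (m + 1 - b.1))
decreasing_by all_goals omega

lemma ff_rec (q : ℤ) (m : ℕ) : ff q (m + 2) = ∑ b ∈ range (m + 1),
    q ^ (b + 1) * gg q (m + 1) (b + 1) * gg q (m + 1) b * (ff q (b + 1) * ff q (m + 1 - b)) := by
  rw [ff, Finset.sum_range]

lemma FF_empty_left (q : ℤ) (J : Finset ℕ) : FF q ∅ J = 0 := by
  unfold FF
  apply sum_eq_zero
  intro S hS
  rw [mem_cls] at hS
  obtain ⟨h1, _, i, j, h⟩ := hS
  rw [image_eq_empty] at h1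
  subst h1
  simpa using h.root

lemma FF_empty_right (q : ℤ) (I : Finset ℕ) : FF q I ∅ = 0 := by
  unfold FF
  apply sum_eq_zero
  intro S hS
  rw [mem_cls] at hS
  obtain ⟨_, h1, i, j, h⟩ := hS
  rw [image_eq_empty] at h1
  subst h1
  simpa using h.root

lemma FF_single (q : ℤ) (i j : ℕ) : FF q {i} {j} = 1 := by
  have : cls {i} {j} = {{(i, j)}} := by
    ext S
    rw [mem_cls, mem_singleton]
    constructor
    · rintro ⟨h1, h2, a, b, h⟩
      ext ⟨x, y⟩
      have key : ∀ x y, (x, y) ∈ S → x = i ∧ y = j := by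
        intro x y hxy
        have e1 := mem_image_of_mem Prod.fst hxy
        have e2 := mem_image_of_mem Prod.snd hxy
        rw [h1, mem_singleton] at e1
        rw [h2, mem_singleton] at e2
        exact ⟨e1, e2⟩
      rw [mem_singleton, Prod.mk.injEq]
      constructor
      · exact key x y
      · rintro ⟨rfl, rfl⟩
        obtain ⟨rfl, rfl⟩ := key _ _ h.root
        exact h.root
    · rintro rfl
      refine ⟨by simp, by simp, i, j, ?_⟩
      constructor <;> simp +contextual
  unfold FF
  rw [this, sum_singleton]
  unfold wt leaf
  simp [cw, filter_singleton]

lemma FF_eq {q : ℤ} (hq : q * q = 1) : ∀ (N : ℕ) (I J : Finset ℕ), #I + #J = N →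
    FF q I J = if #I = #J then ff q #I else 0 := by
  intro N
  induction N using Nat.strong_induction_on with
  | _ N ih =>
    intro I J hN
    rcases I.eq_empty_or_nonempty with rfl | hI
    · rw [FF_empty_left]; simp [ff]
    rcases J.eq_empty_or_nonempty with rfl | hJ
    · rw [FF_empty_right]
      simp [hI.ne_empty]
    obtain ⟨i0, X, hX, rfl⟩ : ∃ i0 X, (∀ x ∈ X, i0 < x) ∧ I = insert i0 X :=
      ⟨I.min' hI, I.erase (I.min' hI), fun x hx => min'_lt_of_mem_erase_min' _ _ hx,
        (insert_erase (min'_mem _ _)).symm⟩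
    obtain ⟨j0, Y, hY, rfl⟩ : ∃ i0 X, (∀ x ∈ X, i0 < x) ∧ J = insert i0 X :=
      ⟨J.min' hJ, J.erase (J.min' hJ), fun x hx => min'_lt_of_mem_erase_min' _ _ hx,
        (insert_erase (min'_mem _ _)).symm⟩
    have hi0 : i0 ∉ X := fun h => lt_irrefl _ (hX _ h)
    have hj0 : j0 ∉ Y := fun h => lt_irrefl _ (hY _ h)
    rw [card_insert_of_notMem hi0, card_insert_of_notMem hj0] at hN ⊢
    by_cases hne : X = ∅ ∧ Y = ∅
    · obtain ⟨rfl, rfl⟩ := hne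
      simp [FF_single, ff]
    rw [FF_rec hq hX hY hne]
    have step : ∀ A ∈ X.powerset, ∀ K ∈ Y.powerset,
        (q ^ #A * WW q A (X \ A) * WW q K (Y \ K)) *
        (FF q A (insert j0 K) * FF q (insert i0 (X \ A)) (Y \ K)) =
        (WW q A (X \ A) * WW q K (Y \ K)) * (if #A = #K + 1 ∧ #X = #Y then
          q ^ #A * (ff q #A * ff q (#Y - #K)) else 0) := by
      intro A hA K hK
      rw [mem_powerset] at hA hK
      have cA := card_le_card hA
      have cK := card_le_card hK
      have c1 : #(insert j0 K) = #K + 1 := card_insert_of_notMem fun h => hj0 (hK h)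
      have c2 : #(insert i0 (X \ A)) = #X - #A + 1 := by
        rw [card_insert_of_notMem (by simp [hi0]), card_sdiff_of_subset hA]
      have c3 : #(Y \ K) = #Y - #K := card_sdiff_of_subset hK
      rw [ih _ (by omega) A (insert j0 K) rfl, ih _ (by omega) (insert i0 (X \ A)) (Y \ K) rfl,
        c1, c2, c3]
      by_cases h1 : #A = #K + 1
      · by_cases h2 : #X = #Y
        · have h3 : #X - #A + 1 = #Y - #K := by omega
          rw [if_pos h1, if_pos h3, if_pos ⟨h1, h2⟩, h3]
          ring
        · have h3 : ¬ (#X - #A + 1 = #Y - #K) := by omega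
          have h4 : ¬ (#A = #K + 1 ∧ #X = #Y) := fun h => h2 h.2
          rw [if_neg h3, if_neg h4]
          ring
      · have h4 : ¬ (#A = #K + 1 ∧ #X = #Y) := fun h => h1 h.1
        rw [if_neg h1, if_neg h4]
        ring
    rw [sum_congr rfl fun A hA => sum_congr rfl fun K hK => step A hA K hK]
    by_cases hXY : #X = #Y
    · obtain ⟨m, hm⟩ : ∃ m, #Y = m + 1 := by
        refine ⟨#Y - 1, ?_⟩
        have : ¬ (#X = 0 ∧ #Y = 0) := by simpa using hne
        omega
      rw [if_pos (by omega), hXY, hm, ff_rec]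
      rw [sum_powerset]
      have e1 : ∀ a ∈ range (#X + 1), ∑ A ∈ powersetCard a X, ∑ K ∈ Y.powerset,
          (WW q A (X \ A) * WW q K (Y \ K)) * (if #A = #K + 1 ∧ m + 1 = m + 1 then
          q ^ #A * (ff q #A * ff q (m + 1 - #K)) else 0) =
          ∑ b ∈ range (#Y + 1), (gg q (m + 1) a * gg q (m + 1) b * (if a = b + 1 then
          q ^ a * (ff q a * ff q (m + 1 - b)) else 0)) := by
        intro a _
        simp_rw [sum_powerset]
        rw [sum_comm]
        refine sum_congr rfl fun b _ => ?_
        have gA := sum_WW q X a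
        have gK := sum_WW q Y b
        rw [hXY, hm] at gA
        rw [hm] at gK
        rw [← gA, ← gK, sum_mul_sum, sum_mul]
        refine sum_congr rfl fun A hA => ?_
        rw [sum_mul]
        refine sum_congr rfl fun K hK => ?_
        rw [(mem_powersetCard.1 hA).2, (mem_powersetCard.1 hK).2]
        simp
      rw [sum_congr rfl e1, sum_comm, hXY, hm, sum_range_succ]
      rw [sum_eq_zero (s := range (m + 1 + 1)) (f := fun a => gg q (m + 1) a * gg q (m + 1) (m + 1) *
        (if a = m + 1 + 1 then q ^ a * (ff q a * ff q (m + 1 - (m + 1))) else 0)), add_zero]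
      · refine sum_congr rfl fun b hb => ?_
        rw [mem_range] at hb
        rw [sum_eq_single (b + 1)]
        · simp; ring
        · intro a _ h
          simp [h]
        · intro h
          exact absurd (mem_range.2 (by omega)) h
      · intro a ha
        rw [mem_range] at ha
        rw [if_neg (by omega), mul_zero]
    · rw [if_neg (by omega)]
      refine sum_eq_zero fun A _ => sum_eq_zero fun K _ => ?_
      rw [if_neg (fun h => hXY h.2), mul_zero]

lemma gg_one : ∀ n a, gg 1 n a = (n.choose a : ℤ)
  | n, 0 => by simp [gg]
  | 0, a + 1 => by simp [gg]
  | n + 1, a + 1 => by rw [gg, gg_one n a, gg_one n (a + 1), Nat.choose_succ_succ]; simp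

lemma gg_zero_of_lt (q : ℤ) : ∀ n a, n < a → gg q n a = 0
  | n, 0, h => by omega
  | 0, a + 1, _ => by simp [gg]
  | n + 1, a + 1, h => by
    rw [gg, gg_zero_of_lt q n a (by omega), gg_zero_of_lt q n (a + 1) (by omega)]; simp

lemma gg_neg : ∀ m : ℕ, (∀ k, gg (-1) (2 * m) (2 * k) = (m.choose k : ℤ)) ∧
    (∀ k, gg (-1) (2 * m) (2 * k + 1) = 0) := by
  intro m
  induction m with
  | zero =>
    refine ⟨fun k => ?_, fun k => ?_⟩
    · cases k with
      | zero => simp [gg]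
      | succ k => simp [gg, Nat.mul_succ]
    · simp [gg]
  | succ m ih =>
    obtain ⟨h1, h2⟩ := ih
    have o1 : ∀ k, gg (-1) (2 * m + 1) (2 * k + 1) = (m.choose k : ℤ) := by
      intro k
      rw [gg, h1, h2]
      by_cases hk : k ≤ m
      · have : Even (2 * m - 2 * k) := ⟨m - k, by omega⟩
        simp [this.neg_one_pow]
      · rw [Nat.choose_eq_zero_of_lt (by omega)]; simp
    have o2 : ∀ k, gg (-1) (2 * m + 1) (2 * k + 2) = (m.choose (k + 1) : ℤ) := by
      intro k
      rw [gg, h2, show 2 * k + 1 + 1 = 2 * (k + 1) by ring, h1]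
      simp
    have o3 : ∀ k, gg (-1) (2 * m + 1) (2 * k) = (m.choose k : ℤ) := by
      intro k
      cases k with
      | zero => simp [gg]
      | succ k => rw [← o2]; rfl
    refine ⟨fun k => ?_, fun k => ?_⟩
    · cases k with
      | zero => simp [gg]
      | succ k =>
        rw [show 2 * (m + 1) = (2 * m + 1) + 1 by ring, show 2 * (k + 1) = 2 * k + 1 + 1 by ring, gg,
          o1, o2, Nat.choose_succ_succ]
        by_cases hk : k ≤ m
        · have : Even (2 * m + 1 - (2 * k + 1)) := ⟨m - k, by omega⟩
          rw [this.neg_one_pow]; simp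
        · rw [Nat.choose_eq_zero_of_lt (show m < k by omega)]; simp
    · rw [show 2 * (m + 1) = (2 * m + 1) + 1 by ring, gg, o1, o3]
      by_cases hk : k ≤ m
      · have : Odd (2 * m + 1 - (2 * k)) := ⟨m - k, by omega⟩
        simp [this.neg_one_pow]
      · rw [Nat.choose_eq_zero_of_lt (by omega)]; simp

lemma gg_neg_odd (m : ℕ) : (∀ k, gg (-1) (2 * m + 1) (2 * k) = (m.choose k : ℤ)) ∧
    (∀ k, gg (-1) (2 * m + 1) (2 * k + 1) = (m.choose k : ℤ)) := by
  obtain ⟨h1, h2⟩ := gg_neg m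
  constructor
  · intro k
    cases k with
    | zero => simp [gg]
    | succ k =>
      rw [show 2 * (k + 1) = 2 * k + 1 + 1 by ring, gg, h2,
        show 2 * k + 1 + 1 = 2 * (k + 1) by ring, h1]
      simp
  · intro k
    rw [gg, h1, h2]
    by_cases hk : k ≤ m
    · have : Even (2 * m - 2 * k) := ⟨m - k, by omega⟩
      simp [this.neg_one_pow]
    · rw [Nat.choose_eq_zero_of_lt (by omega)]; simp

lemma ff_odd (m : ℕ) : ff (-1) (2 * m + 3) = 0 := by
  rw [show 2 * m + 3 = (2 * m + 1) + 2 by ring, ff_rec]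
  refine sum_eq_zero fun b _ => ?_
  have h := (gg_neg (m + 1)).2
  rw [show 2 * m + 1 + 1 = 2 * (m + 1) by ring]
  rcases Nat.even_or_odd' b with ⟨k, rfl | rfl⟩
  · rw [h]; ring
  · rw [h]; ring

lemma sum_range_two_mul (f : ℕ → ℤ) (m : ℕ) :
    ∑ b ∈ range (2 * m), f b = ∑ k ∈ range m, (f (2 * k) + f (2 * k + 1)) := by
  induction m with
  | zero => simp
  | succ m ih =>
    rw [show 2 * (m + 1) = 2 * m + 1 + 1 by ring, sum_range_succ, sum_range_succ, ih, sum_range_succ]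
    ring

lemma ff_even (m : ℕ) (hm : 1 ≤ m) : ff (-1) (2 * m) = (-1) ^ m * ff 1 m := by
  induction m using Nat.strong_induction_on with
  | _ m ih =>
    obtain ⟨m, rfl⟩ : ∃ k, m = k + 1 := ⟨m - 1, by omega⟩
    cases m with
    | zero => simp [ff_rec (-1) 0, ff, gg]
    | succ m =>
      rw [show 2 * (m + 1 + 1) = (2 * m + 2) + 2 by ring, ff_rec, ff_rec,
        sum_range_succ, show 2 * m + 2 = 2 * (m + 1) by ring, sum_range_two_mul]
      have hl : ff (-1) (2 * (m + 1) + 1) = 0 := ff_odd m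
      rw [hl, zero_mul, mul_zero, add_zero, mul_sum]
      refine sum_congr rfl fun k hk => ?_
      rw [mem_range] at hk
      obtain ⟨g1, g2⟩ := gg_neg_odd (m + 1)
      have hz : ff (-1) (2 * k + 1) * ff (-1) (2 * (m + 1) + 1 - 2 * k) = 0 := by
        have : 2 * (m + 1) + 1 - 2 * k = 2 * (m - k) + 3 := by omega
        rw [this, ff_odd, mul_zero]
      rw [hz, mul_zero, zero_add, show 2 * k + 1 + 1 = 2 * (k + 1) by ring,
        show 2 * (m + 1) + 1 - (2 * k + 1) = 2 * (m + 1 - k) by omega, g1, g2,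
        ih (k + 1) (by omega) (by omega), ih (m + 1 - k) (by omega) (by omega), gg_one, gg_one]
      have e : (-1 : ℤ) ^ (m + 1 + 1) = (-1) ^ (k + 1) * (-1) ^ (m + 1 - k) := by
        rw [← pow_add]; congr 1; omega
      rw [e, pow_mul]
      simp
      ring

def toS {n : ℕ} (M : CNAT n) : Finset (ℕ × ℕ) :=
  ((univ : Finset (Fin n × Fin n)).filter (fun p => M.dot p.1 p.2 = true)).image
    (fun p => (p.1.1, p.2.1))

lemma mem_toS {n : ℕ} (M : CNAT n) {i j : ℕ} :
    (i, j) ∈ toS M ↔ ∃ (hi : i < n) (hj : j < n), M.dot ⟨i, hi⟩ ⟨j, hj⟩ = true := by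
  unfold toS
  rw [mem_image]
  constructor
  · rintro ⟨⟨a, b⟩, h1, h2⟩
    simp only [Prod.mk.injEq] at h2
    obtain ⟨rfl, rfl⟩ := h2
    exact ⟨a.2, b.2, (mem_filter.1 h1).2⟩
  · rintro ⟨hi, hj, h⟩
    exact ⟨(⟨i, hi⟩, ⟨j, hj⟩), mem_filter.2 ⟨mem_univ _, h⟩, rfl⟩

lemma toS_isC {n : ℕ} (hn : 1 ≤ n) (M : CNAT n) : IsC 0 0 (toS M) := by
  constructor
  · exact (mem_toS M).2 ⟨hn, hn, M.root hn⟩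
  · intros; omega
  · intro i j hij hne
    obtain ⟨hi, hj, h⟩ := (mem_toS M).1 hij
    have hx := M.nonambiguous ⟨i, hi⟩ ⟨j, hj⟩ h hne
    have e1 : (∃ i', i' < i ∧ (i', j) ∈ toS M) ↔
        (∃ i' : Fin n, i' < ⟨i, hi⟩ ∧ M.dot i' ⟨j, hj⟩ = true) := by
      constructor
      · rintro ⟨i', h1, h2⟩
        obtain ⟨a, b, h3⟩ := (mem_toS M).1 h2
        exact ⟨⟨i', a⟩, h1, h3⟩
      · rintro ⟨i', h1, h2⟩
        exact ⟨i'.1, h1, (mem_toS M).2 ⟨i'.2, hj, h2⟩⟩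
    have e2 : (∃ j', j' < j ∧ (i, j') ∈ toS M) ↔
        (∃ j' : Fin n, j' < ⟨j, hj⟩ ∧ M.dot ⟨i, hi⟩ j' = true) := by
      constructor
      · rintro ⟨i', h1, h2⟩
        obtain ⟨a, b, h3⟩ := (mem_toS M).1 h2
        exact ⟨⟨i', b⟩, h1, h3⟩
      · rintro ⟨i', h1, h2⟩
        exact ⟨i'.1, h1, (mem_toS M).2 ⟨hi, i'.2, h2⟩⟩
    rw [e1, e2]
    exact hx
  · intro i j hij
    obtain ⟨hi, hj, h⟩ := (mem_toS M).1 hij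
    have hx := M.complete ⟨i, hi⟩ ⟨j, hj⟩ h
    constructor
    · rintro ⟨i', h1, h2⟩
      obtain ⟨a, b, h3⟩ := (mem_toS M).1 h2
      obtain ⟨j', h4, h5⟩ := hx.1 ⟨⟨i', a⟩, h1, h3⟩
      exact ⟨j'.1, h4, (mem_toS M).2 ⟨hi, j'.2, h5⟩⟩
    · rintro ⟨i', h1, h2⟩
      obtain ⟨a, b, h3⟩ := (mem_toS M).1 h2
      obtain ⟨j', h4, h5⟩ := hx.2 ⟨⟨i', b⟩, h1, h3⟩
      exact ⟨j'.1, h4, (mem_toS M).2 ⟨j'.2, hj, h5⟩⟩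

lemma toS_mem_cls {n : ℕ} (hn : 1 ≤ n) (M : CNAT n) : toS M ∈ cls (range n) (range n) := by
  rw [mem_cls]
  refine ⟨?_, ?_, 0, 0, toS_isC hn M⟩
  · ext i
    rw [mem_image, mem_range]
    constructor
    · rintro ⟨⟨a, b⟩, h, rfl⟩
      exact ((mem_toS M).1 h).1
    · intro hi
      obtain ⟨j, hj⟩ := M.min_row ⟨i, hi⟩
      exact ⟨(i, j), (mem_toS M).2 ⟨hi, j.2, hj⟩, rfl⟩
  · ext i
    rw [mem_image, mem_range]
    constructor
    · rintro ⟨⟨a, b⟩, h, rfl⟩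
      exact ((mem_toS M).1 h).2.1
    · intro hi
      obtain ⟨j, hj⟩ := M.min_col ⟨i, hi⟩
      exact ⟨(j, i), (mem_toS M).2 ⟨j.2, hi, hj⟩, rfl⟩

lemma dot_injective (n : ℕ) : Function.Injective (CNAT.dot : CNAT n → _) := by
  rintro ⟨d, _, _, _, _, _⟩ ⟨d', _, _, _, _, _⟩ h
  simp only at h
  subst h
  rfl

lemma toS_injective (n : ℕ) : Function.Injective (toS : CNAT n → _) := by
  intro M M' h
  apply dot_injective
  funext i j
  rw [Bool.eq_iff_iff]
  have h1 : ((i.1, j.1) ∈ toS M ↔ (i.1, j.1) ∈ toS M') := by rw [h]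
  rw [mem_toS, mem_toS] at h1
  simpa using h1

lemma toS_surj {n : ℕ} (hn : 1 ≤ n) {S : Finset (ℕ × ℕ)} (hS : S ∈ cls (range n) (range n)) :
    ∃ M : CNAT n, toS M = S := by
  rw [mem_cls] at hS
  obtain ⟨hr, hc, a, b, hC⟩ := hS
  have hr' : ∀ i, (i < n) ↔ ∃ j, (i, j) ∈ S := by
    intro i; rw [← mem_range, ← hr]; simp
  have hc' : ∀ j, (j < n) ↔ ∃ i, (i, j) ∈ S := by
    intro i; rw [← mem_range, ← hc]; simp
  have ha : a = 0 := by
    obtain ⟨j, hj⟩ := (hr' 0).1 hn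
    have := hC.le _ _ hj; omega
  have hb : b = 0 := by
    obtain ⟨j, hj⟩ := (hc' 0).1 hn
    have := hC.le _ _ hj; omega
  subst ha hb
  have lt1 : ∀ i j, (i, j) ∈ S → i < n := fun i j h => (hr' i).2 ⟨j, h⟩
  have lt2 : ∀ i j, (i, j) ∈ S → j < n := fun i j h => (hc' j).2 ⟨i, h⟩
  have E1 : ∀ (P : ℕ → Prop) (j : ℕ), (∃ i : Fin n, P i.1 ∧ decide ((i.1, j) ∈ S) = true) ↔
      ∃ i, P i ∧ (i, j) ∈ S := by
    intro P j
    constructor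
    · rintro ⟨i, h1, h2⟩; exact ⟨i, h1, by simpa using h2⟩
    · rintro ⟨i, h1, h2⟩; exact ⟨⟨i, lt1 _ _ h2⟩, h1, by simpa using h2⟩
  have E2 : ∀ (P : ℕ → Prop) (i : ℕ), (∃ j : Fin n, P j.1 ∧ decide ((i, j.1) ∈ S) = true) ↔
      ∃ j, P j ∧ (i, j) ∈ S := by
    intro P j
    constructor
    · rintro ⟨i, h1, h2⟩; exact ⟨i, h1, by simpa using h2⟩
    · rintro ⟨i, h1, h2⟩; exact ⟨⟨i, lt2 _ _ h2⟩, h1, by simpa using h2⟩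
  refine ⟨⟨fun i j => decide ((i.1, j.1) ∈ S), ?_, ?_, ?_, ?_, ?_⟩, ?_⟩
  · intro h; simpa using hC.root
  · intro i j hij hne
    have := hC.na i j (by simpa using hij) hne
    rw [← E1 (fun x => x < i.1), ← E2 (fun x => x < j.1)] at this
    exact this
  · intro i
    obtain ⟨j, hj⟩ := (hr' i).1 i.2
    exact ⟨⟨j, lt2 _ _ hj⟩, by simpa using hj⟩
  · intro i
    obtain ⟨j, hj⟩ := (hc' i).1 i.2
    exact ⟨⟨j, lt1 _ _ hj⟩, by simpa using hj⟩
  · intro i j hij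
    have := hC.co i j (by simpa using hij)
    rw [← E1 (fun x => i.1 < x), ← E2 (fun x => j.1 < x)] at this
    exact this
  · ext ⟨i, j⟩
    rw [mem_toS]
    simp only [decide_eq_true_eq, exists_prop]
    exact ⟨fun h => h.2.2, fun h => ⟨lt1 _ _ h, lt2 _ _ h, h⟩⟩

lemma exists_last {n : ℕ} (M : CNAT n) (i : Fin n) :
    ∃ j, M.dot i j = true ∧ ∀ j', M.dot i j' = true → j' ≤ j := by
  have hne : (univ.filter (fun j => M.dot i j = true)).Nonempty := by
    obtain ⟨j, hj⟩ := M.min_row i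
    exact ⟨j, by simp [hj]⟩
  obtain ⟨j, h1, h2⟩ := exists_max_image _ id hne
  exact ⟨j, (mem_filter.1 h1).2, fun j' h => h2 j' (by simp [h])⟩

lemma det_eq {n : ℕ} (M : CNAT n) : cnatDet M = wt (-1) (toS M) := by
  choose p hp1 hp2 using exists_last M
  have hinj : Function.Injective p := by
    have key : ∀ i i', i < i' → p i ≠ p i' := by
      intro i i' hlt heq
      obtain ⟨j', h1, h2⟩ := (M.complete i (p i) (hp1 i)).1 ⟨i', hlt, heq ▸ hp1 i'⟩
      exact absurd (hp2 i j' h2) (not_le.2 h1)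
    intro i i' heq
    rcases lt_trichotomy i i' with h | h | h
    · exact absurd heq (key _ _ h)
    · exact h
    · exact absurd heq.symm (key _ _ h)
  let e : Equiv.Perm (Fin n) := Equiv.ofBijective p (Finite.injective_iff_bijective.1 hinj)
  have he : ∀ i, e i = p i := fun i => rfl
  have hdet : cnatDet M = (Equiv.Perm.sign e : ℤ) := by
    unfold cnatDet
    rw [Matrix.det_apply', sum_eq_single e⁻¹]
    · rw [prod_eq_one, mul_one, Equiv.Perm.sign_inv]
      · simp
      · intro i _
        have : M.dot (e.symm i) i = true := by
          have h := hp1 (e.symm i)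
          rw [← he, Equiv.apply_symm_apply] at h
          exact h
        simp [this]
    · intro s _ hs
      by_contra hcon
      apply hs
      have h0 := (mul_ne_zero_iff.1 hcon).2
      rw [prod_ne_zero_iff] at h0
      have hle : ∀ i ∈ (univ : Finset (Fin n)), (i : ℕ) ≤ ((e * s) i : Fin n).1 := by
        intro i hi
        have h1 := h0 i hi
        simp only [Matrix.of_apply, ne_eq, ite_eq_right_iff, one_ne_zero, imp_false,
          not_not] at h1
        exact hp2 _ _ h1
      have hsum : ∑ i : Fin n, (i : ℕ) = ∑ i : Fin n, ((e * s) i : Fin n).1 :=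
        (Equiv.sum_comp (e * s) (fun i : Fin n => (i : ℕ))).symm
      have heq := (sum_eq_sum_iff_of_le hle).1 hsum
      rw [eq_inv_iff_mul_eq_one, ]
      have h1 : e * s = 1 := by
        ext i
        rw [← heq i (mem_univ _)]
        simp
      exact mul_eq_one_comm.1 h1
    · intro h; exact absurd (mem_univ _) h
  have hleaf : leaf (toS M) = univ.image (fun i : Fin n => (i.1, (p i).1)) := by
    ext ⟨i, j⟩
    rw [mem_leaf, mem_image]
    constructor
    · rintro ⟨h1, h2⟩
      obtain ⟨hi, hj, h⟩ := (mem_toS M).1 h1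
      refine ⟨⟨i, hi⟩, mem_univ _, ?_⟩
      have h3 := hp2 _ _ h
      have h4 := h2 (p ⟨i, hi⟩).1 ((mem_toS M).2 ⟨hi, (p ⟨i, hi⟩).2, hp1 _⟩)
      rw [Prod.mk.injEq]
      exact ⟨rfl, le_antisymm h4 h3⟩
    · rintro ⟨a, _, h⟩
      rw [Prod.mk.injEq] at h
      obtain ⟨rfl, rfl⟩ := h
      refine ⟨(mem_toS M).2 ⟨a.2, (p a).2, hp1 a⟩, fun j' h' => ?_⟩
      obtain ⟨hi, hj, h⟩ := (mem_toS M).1 h'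
      exact hp2 a ⟨j', hj⟩ h
  have hi : Set.InjOn (fun i : Fin n => (i.1, (p i).1)) ((univ : Finset (Fin n)) : Set (Fin n)) := by
    intro a _ b _ h
    simp only [Prod.mk.injEq] at h
    exact Fin.ext h.1
  rw [hdet, wt, hleaf, prod_image hi, Equiv.Perm.sign_eq_prod_prod_Ioi, Units.coe_prod]
  refine prod_congr rfl fun i _ => ?_
  rw [prod_image hi, Units.coe_prod]
  refine prod_subset_one_on_sdiff (subset_univ _) (fun j hj => ?_) (fun j hj => ?_)
  · have h1 : ¬ i < j := by simpa using hj
    have h2 : ¬ i.1 < j.1 := h1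
    simp [cw, h2]
  · have h1 : i < j := by simpa using hj
    have h2 : i.1 < j.1 := h1
    have h3 : p i ≠ p j := fun h => h1.ne (hinj h)
    rw [he, he]
    rcases lt_or_gt_of_ne h3 with h | h
    · have h4 : ¬ (p j).1 < (p i).1 := not_lt.2 (le_of_lt h)
      simp [cw, h, h4]
    · have h4 : (p j).1 < (p i).1 := h
      simp [cw, h4, h2, h.not_gt]

lemma card_eq (n : ℕ) (hn : 1 ≤ n) (q : ℤ) [Fintype (CNAT n)] :
    ∑ M : CNAT n, wt q (toS M) = FF q (range n) (range n) := by
  unfold FF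
  refine sum_bij (fun M _ => toS M) (fun M _ => toS_mem_cls hn M)
    (fun M _ M' _ h => toS_injective n h) (fun S hS => ?_) (fun _ _ => rfl)
  obtain ⟨M, hM⟩ := toS_surj hn hS
  exact ⟨M, mem_univ _, hM⟩

lemma wt_one (S : Finset (ℕ × ℕ)) : wt 1 S = 1 := by
  unfold wt cw
  simp

lemma wt_neg_one (S : Finset (ℕ × ℕ)) : wt (-1) S = 1 ∨ wt (-1) S = -1 := by
  have : IsUnit (wt (-1) S) := by
    unfold wt
    rw [IsUnit.prod_iff]
    intro u _
    rw [IsUnit.prod_iff]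
    intro v _
    unfold cw
    split_ifs <;> simp
  exact Int.isUnit_iff.1 this

lemma ff_range {n : ℕ} {q : ℤ} (hq : q * q = 1) : FF q (range n) (range n) = ff q n := by
  rw [FF_eq hq _ _ _ rfl]; simp

lemma cnatD_eq (n : ℕ) (hn : 1 ≤ n) : cnatD n = ff (-1) n := by
  classical
  have : Finite (CNAT n) := Finite.of_injective _ (dot_injective n)
  have : Fintype (CNAT n) := Fintype.ofFinite _
  rw [← ff_range (by norm_num), ← card_eq n hn]
  unfold cnatD cnatA cnatB
  rw [Nat.card_eq_fintype_card, Nat.card_eq_fintype_card, Fintype.card_subtype,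
    Fintype.card_subtype, card_filter, card_filter]
  push_cast
  rw [← sum_sub_distrib]
  refine sum_congr rfl fun M _ => ?_
  rw [det_eq]
  rcases wt_neg_one (toS M) with h | h <;> rw [h] <;> norm_num

lemma cnatT_eq (n : ℕ) (hn : 1 ≤ n) : (cnatT n : ℤ) = ff 1 n := by
  classical
  have : Finite (CNAT n) := Finite.of_injective _ (dot_injective n)
  have : Fintype (CNAT n) := Fintype.ofFinite _
  rw [← ff_range (by norm_num), ← card_eq n hn]
  unfold cnatT cnatA cnatB
  rw [Nat.card_eq_fintype_card, Nat.card_eq_fintype_card, Fintype.card_subtype,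
    Fintype.card_subtype, card_filter, card_filter]
  push_cast
  rw [← sum_add_distrib]
  refine sum_congr rfl fun M _ => ?_
  rw [det_eq, wt_one]
  rcases wt_neg_one (toS M) with h | h <;> rw [h] <;> norm_num

end CN

theorem cnat_defect (n : ℕ) (hn : 1 ≤ n) :
    cnatD n =
      if n = 1 then 1
      else if Odd n then 0
      else (-1 : ℤ) ^ (n / 2) * (cnatT (n / 2) : ℤ) := by
  
  rw [CN.cnatD_eq n hn]
  split_ifs with h1 h2
  · subst h1; simp [CN.ff]
  · obtain ⟨k, rfl⟩ := h2
    obtain ⟨m, rfl⟩ : ∃ m, k = m + 1 := ⟨k - 1, by omega⟩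
    exact CN.ff_odd m
  · obtain ⟨k, hk⟩ := Nat.not_odd_iff_even.1 h2
    have e : n / 2 = k := by omega
    rw [e, CN.cnatT_eq k (by omega), ← CN.ff_even k (by omega)]
    congr 1
    omega
end

section
/- For every odd natural number n > 1, the number of CNATs of size n with determinant 1 equals the number of CNATs of size n with determinant −1; that is, A_n = B_n = T_n / 2. -/
namespace CNATProof

theorem dot_ext {n : ℕ} {M N : CNAT n} (h : ∀ i j, M.dot i j = N.dot i j) : M = N := by
  cases M; cases N
  congr
  funext i j
  exact h i j

/-- The two-colouring of rows and columns by the two subtrees of the root. -/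
structure Coloring {n : ℕ} (M : CNAT n) (r c : Fin n → Prop) : Prop where
  r0 : ∀ i : Fin n, (i : ℕ) = 0 → ¬ r i
  c0 : ∀ j : Fin n, (j : ℕ) = 0 → c j
  con : ∀ i j : Fin n, M.dot i j = true → ¬((i : ℕ) = 0 ∧ (j : ℕ) = 0) → (r i ↔ c j)

inductive LR {n : ℕ} (M : CNAT n) : Fin n → Prop
  | base (i i' j : Fin n) (h : i' < i) (h1 : M.dot i j = true) (h2 : M.dot i' j = true)
      (h0 : (j : ℕ) = 0) : LR M i
  | step (i i' j : Fin n) (h : i' < i) (h1 : M.dot i j = true) (h2 : M.dot i' j = true)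
      (h0 : LR M i') : LR M i

theorem above_unique {n : ℕ} (M : CNAT n) {i i1 i2 j1 j2 : Fin n}
    (h1 : M.dot i j1 = true) (h2 : M.dot i j2 = true)
    (l1 : i1 < i) (l2 : i2 < i) (d1 : M.dot i1 j1 = true) (d2 : M.dot i2 j2 = true) :
    j1 = j2 := by
  have hi : (i : ℕ) ≠ 0 := by have : (i1 : ℕ) < i := l1; omega
  rcases lt_trichotomy j1 j2 with h | h | h
  · rcases M.nonambiguous i j2 h2 (fun h => hi h.1) with ⟨_, hh⟩ | ⟨_, hh⟩
    · exact absurd ⟨j1, h, h1⟩ hh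
    · exact absurd ⟨i2, l2, d2⟩ hh
  · exact h
  · rcases M.nonambiguous i j1 h1 (fun h => hi h.1) with ⟨_, hh⟩ | ⟨_, hh⟩
    · exact absurd ⟨j2, h, h2⟩ hh
    · exact absurd ⟨i1, l1, d1⟩ hh

theorem LR_transfer {n : ℕ} (M : CNAT n) (i' : Fin n) (h : LR M i') :
    ∀ i j : Fin n, (j : ℕ) ≠ 0 → M.dot i' j = true → M.dot i j = true → LR M i := by
  induction h with
  | base i' i'' j'' hlt h1 h2 h0 =>
    intro i j hj d1 d2
    rcases lt_trichotomy i i' with h | h | h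
    · have := above_unique M d1 h1 h hlt d2 h2
      subst this; exact absurd h0 hj
    · subst h; exact LR.base _ _ _ hlt h1 h2 h0
    · exact LR.step _ _ _ h d2 d1 (LR.base _ _ _ hlt h1 h2 h0)
  | step i' i'' j'' hlt h1 h2 h0 ih =>
    intro i j hj d1 d2
    rcases lt_trichotomy i i' with h | h | h
    · have := above_unique M d1 h1 h hlt d2 h2
      subst this; exact ih i j hj h2 d2
    · subst h; exact LR.step _ _ _ hlt h1 h2 h0
    · exact LR.step _ _ _ h d2 d1 (LR.step _ _ _ hlt h1 h2 h0)

theorem coloring_LR {n : ℕ} (M : CNAT n) :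
    Coloring M (LR M) (fun j => (j : ℕ) = 0 ∨ ∃ i, M.dot i j = true ∧ LR M i) where
  r0 := by
    intro i hi h
    cases h with
    | base i i' j h => have : (i' : ℕ) < i := h; omega
    | step i i' j h => have : (i' : ℕ) < i := h; omega
  c0 := fun j h => Or.inl h
  con := by
    intro i j d hne
    refine ⟨fun h => Or.inr ⟨i, d, h⟩, ?_⟩
    intro h
    by_cases hj : (j : ℕ) = 0
    · have hi : 0 < (i : ℕ) := by omega
      have hn : 0 < n := by omega
      have hr := M.root hn
      have hj' : j = ⟨0, hn⟩ := Fin.ext hj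
      subst hj'
      exact LR.base i ⟨0, hn⟩ _ hi d hr rfl
    · rcases h with h | ⟨i', d', h⟩
      · exact absurd h hj
      · exact LR_transfer M i' h i j hj d' d

theorem exists_parent {n : ℕ} (M : CNAT n) (i : Fin n) (hi : (i : ℕ) ≠ 0) :
    ∃ i' j, i' < i ∧ M.dot i j = true ∧ M.dot i' j = true := by
  have key : ∀ k : ℕ, ∀ j : Fin n, (j : ℕ) = k → M.dot i j = true →
      ∃ i' j, i' < i ∧ M.dot i j = true ∧ M.dot i' j = true := by
    intro k
    induction k using Nat.strong_induction_on with
    | _ k ih =>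
      intro j hj d
      rcases M.nonambiguous i j d (fun h => hi h.1) with ⟨⟨i', h1, h2⟩, _⟩ | ⟨⟨j', h1, h2⟩, _⟩
      · exact ⟨i', j, h1, d, h2⟩
      · exact ih j' (hj ▸ h1) j' rfl h2
  obtain ⟨j, d⟩ := M.min_row i
  exact key _ j rfl d

theorem Coloring.r_eq {n : ℕ} {M : CNAT n} {r c : Fin n → Prop} (h : Coloring M r c) :
    r = LR M := by
  have h1 : ∀ i, LR M i → r i := by
    intro i hi
    induction hi with
    | base i i' j hlt d1 d2 h0 =>
      have : (i' : ℕ) < i := hlt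
      exact (h.con i j d1 (by omega)).2 (h.c0 j h0)
    | step i i' j hlt d1 d2 h0 ih =>
      have : (i' : ℕ) < i := hlt
      refine (h.con i j d1 (by omega)).2 ?_
      by_cases hj : (j : ℕ) = 0
      · exact h.c0 j hj
      · exact (h.con i' j d2 (by omega)).1 ih
  have h2 : ∀ k : ℕ, ∀ i : Fin n, (i : ℕ) = k → r i → LR M i := by
    intro k
    induction k using Nat.strong_induction_on with
    | _ k ih =>
      intro i hk hr
      have hi : (i : ℕ) ≠ 0 := fun h0 => h.r0 i h0 hr
      obtain ⟨i', j, hlt, d1, d2⟩ := exists_parent M i hi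
      by_cases hj : (j : ℕ) = 0
      · exact LR.base _ _ _ hlt d1 d2 hj
      · refine LR.step _ _ _ hlt d1 d2 (ih i' (hk ▸ hlt) i' rfl ?_)
        exact (h.con i' j d2 (by omega)).2 ((h.con i j d1 (by omega)).1 hr)
  funext i
  exact propext ⟨h2 _ i rfl, h1 i⟩

theorem Coloring.unique {n : ℕ} {M : CNAT n} {r c r' c' : Fin n → Prop} (h : Coloring M r c)
    (h' : Coloring M r' c') : r = r' ∧ c = c' := by
  have hr : r = r' := h.r_eq.trans h'.r_eq.symm
  refine ⟨hr, ?_⟩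
  subst hr
  funext j
  by_cases hj : (j : ℕ) = 0
  · exact propext ⟨fun _ => h'.c0 j hj, fun _ => h.c0 j hj⟩
  · obtain ⟨i, d⟩ := M.min_col j
    exact propext ((h.con i j d (by omega)).symm.trans (h'.con i j d (by omega)))

/-- The transposed CNAT. -/
def transp {n : ℕ} (M : CNAT n) : CNAT n where
  dot i j := M.dot j i
  root := M.root
  nonambiguous i j d h := (xor_comm _ _).mp (M.nonambiguous j i d (fun hh => h hh.symm))
  min_row := M.min_col
  min_col := M.min_row
  complete i j d := (M.complete j i d).symm

theorem swap_lt {n : ℕ} {a b x y : Fin n} (hab : (b : ℕ) = a + 1)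
    (h : ¬ (x = a ∧ y = b)) (hxy : x < y) : Equiv.swap a b x < Equiv.swap a b y := by
  rw [Equiv.swap_apply_def, Equiv.swap_apply_def]
  simp only [Fin.ext_iff, Fin.lt_def] at *
  split_ifs <;> omega

theorem swap_zero {n : ℕ} {a b i : Fin n} (ha : (a : ℕ) ≠ 0) (hb : (b : ℕ) ≠ 0) :
    ((Equiv.swap a b i : Fin n) : ℕ) = 0 ↔ (i : ℕ) = 0 := by
  rw [Equiv.swap_apply_def]
  split_ifs with h1 h2
  · subst h1; omega
  · subst h2; omega
  · rfl

theorem exists_rowSwap {n : ℕ} (M : CNAT n) (a b : Fin n) (ha : (a : ℕ) ≠ 0)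
    (hab : (b : ℕ) = a + 1) (hd : ∀ j, M.dot a j = true → M.dot b j = true → False) :
    ∃ M' : CNAT n, ∀ i j, M'.dot i j = M.dot (Equiv.swap a b i) j := by
  have hb : (b : ℕ) ≠ 0 := by omega
  have mono : ∀ x y j, M.dot x j = true → M.dot y j = true → x < y →
      Equiv.swap a b x < Equiv.swap a b y := by
    intro x y j d1 d2 hxy
    refine swap_lt hab ?_ hxy
    rintro ⟨rfl, rfl⟩
    exact hd j d1 d2
  have e1 : ∀ i j, M.dot (Equiv.swap a b i) j = true →
      ((∃ i', i' < i ∧ M.dot (Equiv.swap a b i') j = true) ↔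
        ∃ i', i' < Equiv.swap a b i ∧ M.dot i' j = true) := by
    intro i j d
    constructor
    · rintro ⟨i', hlt, d'⟩
      refine ⟨Equiv.swap a b i', ?_, d'⟩
      by_contra hcon
      rcases (not_lt.1 hcon).lt_or_eq with h | h
      · have := mono _ _ j d d' h
        simp only [Equiv.swap_apply_self] at this
        exact absurd this (not_lt.2 hlt.le)
      · exact absurd ((Equiv.swap a b).injective h) hlt.ne'
    · rintro ⟨i', hlt, d'⟩
      refine ⟨Equiv.swap a b i', ?_, by simpa using d'⟩
      have := mono _ _ j d' d hlt
      simpa using this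
  have e2 : ∀ i j, M.dot (Equiv.swap a b i) j = true →
      ((∃ i', i < i' ∧ M.dot (Equiv.swap a b i') j = true) ↔
        ∃ i', Equiv.swap a b i < i' ∧ M.dot i' j = true) := by
    intro i j d
    constructor
    · rintro ⟨i', hlt, d'⟩
      refine ⟨Equiv.swap a b i', ?_, d'⟩
      by_contra hcon
      rcases (not_lt.1 hcon).lt_or_eq with h | h
      · have := mono _ _ j d' d h
        simp only [Equiv.swap_apply_self] at this
        exact absurd this (not_lt.2 hlt.le)
      · exact absurd ((Equiv.swap a b).injective h) hlt.ne'
    · rintro ⟨i', hlt, d'⟩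
      refine ⟨Equiv.swap a b i', ?_, by simpa using d'⟩
      have := mono _ _ j d d' hlt
      simpa using this
  refine ⟨⟨fun i j => M.dot (Equiv.swap a b i) j, ?_, ?_, ?_, ?_, ?_⟩, fun _ _ => rfl⟩
  · intro h
    have : Equiv.swap a b ⟨0, h⟩ = ⟨0, h⟩ := Fin.ext ((swap_zero ha hb).2 rfl)
    rw [this]; exact M.root h
  · intro i j d hne
    rw [e1 i j d]
    exact M.nonambiguous _ j d (by rwa [swap_zero ha hb])
  · intro i; exact M.min_row _
  · intro j
    obtain ⟨i, d⟩ := M.min_col j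
    exact ⟨Equiv.swap a b i, by simpa using d⟩
  · intro i j d
    rw [e2 i j d]
    exact M.complete _ j d

/-- `(a, b)` is the first pair `(2t+1, 2t+2)` on which `r` differs. -/
def FirstMix {n : ℕ} (r : Fin n → Prop) (a b : Fin n) : Prop :=
  ∃ t : ℕ, (a : ℕ) = 2 * t + 1 ∧ (b : ℕ) = 2 * t + 2 ∧ ¬(r a ↔ r b) ∧
    ∀ s < t, ∀ x y : Fin n, (x : ℕ) = 2 * s + 1 → (y : ℕ) = 2 * s + 2 → (r x ↔ r y)

theorem FirstMix.unique {n : ℕ} {r : Fin n → Prop} {a b a' b' : Fin n}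
    (h : FirstMix r a b) (h' : FirstMix r a' b') : a = a' ∧ b = b' := by
  obtain ⟨t, h1, h2, h3, h4⟩ := h
  obtain ⟨t', h1', h2', h3', h4'⟩ := h'
  have : t = t' := by
    rcases lt_trichotomy t t' with h | h | h
    · exact absurd (h4' t h a b h1 h2) h3
    · exact h
    · exact absurd (h4 t' h a' b' h1' h2') h3'
  subst this
  exact ⟨Fin.ext (by omega), Fin.ext (by omega)⟩

theorem FirstMix.swap {n : ℕ} {r : Fin n → Prop} {a b : Fin n}
    (h : FirstMix r a b) : FirstMix (fun i => r (Equiv.swap a b i)) a b := by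
  obtain ⟨t, h1, h2, h3, h4⟩ := h
  refine ⟨t, h1, h2, ?_, ?_⟩
  · simp only [Equiv.swap_apply_left, Equiv.swap_apply_right]
    exact fun h => h3 h.symm
  · intro s hs x y hx hy
    simp only
    rw [Equiv.swap_apply_of_ne_of_ne, Equiv.swap_apply_of_ne_of_ne]
    · exact h4 s hs x y hx hy
    all_goals (rintro rfl; omega)

theorem sum_pairs (f : ℕ → ℕ) (h : ℕ) (hf : ∀ t < h, f (2 * t + 1) = f (2 * t + 2)) :
    (∑ i ∈ Finset.range (2 * h + 1), f i) % 2 = f 0 % 2 := by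
  induction h with
  | zero => simp
  | succ h ih =>
    have := ih (fun t ht => hf t (by omega))
    have h2 := hf h (by omega)
    rw [show 2 * (h + 1) + 1 = 2 * h + 1 + 1 + 1 by ring, Finset.sum_range_succ,
      Finset.sum_range_succ]
    have h3 : f (2 * h + 1 + 1) = f (2 * h + 1) := h2.symm
    omega

open Classical in
theorem parity {n : ℕ} (hodd : Odd n) (r : Fin n → Prop) (hr : ∀ a b, ¬ FirstMix r a b)
    (z : Fin n) (hz : (z : ℕ) = 0) :
    (Finset.univ.filter r).card % 2 = if r z then 1 else 0 := by
  obtain ⟨h, rfl⟩ := hodd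
  have all : ∀ t : ℕ, ∀ x y : Fin (2 * h + 1), (x : ℕ) = 2 * t + 1 → (y : ℕ) = 2 * t + 2 →
      (r x ↔ r y) := by
    intro t
    induction t using Nat.strong_induction_on with
    | _ t ih =>
      intro x y hx hy
      by_contra hc
      exact hr x y ⟨t, hx, hy, hc, ih⟩
  let f : ℕ → ℕ := fun i => if hi : i < 2 * h + 1 then (if r ⟨i, hi⟩ then 1 else 0) else 0
  have hf : ∀ t < h, f (2 * t + 1) = f (2 * t + 2) := by
    intro t ht
    have h1 : 2 * t + 1 < 2 * h + 1 := by omega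
    have h2 : 2 * t + 2 < 2 * h + 1 := by omega
    simp only [f, dif_pos h1, dif_pos h2]
    have := all t ⟨_, h1⟩ ⟨_, h2⟩ rfl rfl
    simp only [this]
  have hs := sum_pairs f h hf
  rw [← Fin.sum_univ_eq_sum_range] at hs
  have hz' : z = ⟨0, by omega⟩ := Fin.ext hz
  rw [Finset.card_filter]
  have e : ∀ i : Fin (2 * h + 1), f i = if r i then 1 else 0 := by
    intro i
    simp only [f, dif_pos i.isLt]
  simp only [e] at hs
  rw [hs]
  have := e z
  rw [hz] at this
  rw [this]
  split_ifs <;> rfl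

theorem exists_leaf {n : ℕ} (M : CNAT n) (i : Fin n) :
    ∃ j, M.dot i j = true ∧ ∀ j', j < j' → ¬ M.dot i j' = true := by
  classical
  have hne : (Finset.univ.filter (fun j => M.dot i j = true)).Nonempty := by
    obtain ⟨j, d⟩ := M.min_row i
    exact ⟨j, by simpa using d⟩
  refine ⟨Finset.max' _ hne, ?_, ?_⟩
  · simpa using Finset.max'_mem _ hne
  · intro j' hlt d
    exact absurd (Finset.le_max' _ j' (by simpa using d)) (not_le.2 hlt)

open Classical in
theorem card_eq {n : ℕ} (hn : 1 < n) (M : CNAT n) {r c : Fin n → Prop} (h : Coloring M r c) :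
    (Finset.univ.filter r).card = (Finset.univ.filter c).card := by
  choose p hp1 hp2 using exists_leaf M
  have hcol : ∀ i i', i < i' → ¬ M.dot i' (p i) = true := by
    intro i i' hlt d
    obtain ⟨j', hj, hd⟩ := (M.complete i (p i) (hp1 i)).1 ⟨i', hlt, d⟩
    exact hp2 i j' hj hd
  have inj : Function.Injective p := by
    intro i i' he
    rcases lt_trichotomy i i' with hl | hl | hl
    · exact absurd (he ▸ hp1 i') (hcol i i' hl)
    · exact hl
    · exact absurd (he ▸ hp1 i) (hcol i' i hl)
  have nonroot : ∀ i : Fin n, ¬((i : ℕ) = 0 ∧ (p i : ℕ) = 0) := by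
    rintro i ⟨hi, hpi⟩
    obtain ⟨i', j, hlt, d1, d2⟩ := exists_parent M ⟨1, hn⟩ (by simp)
    have hlt' : (i' : ℕ) < 1 := hlt
    have e : i' = i := Fin.ext (by omega)
    subst e
    by_cases hj : j = p i'
    · subst hj
      exact hcol i' _ hlt d1
    · refine hp2 i' j ?_ d2
      have : (j : ℕ) ≠ p i' := fun h => hj (Fin.ext h)
      show (p i' : ℕ) < j
      omega
  have bij : Function.Bijective p := Finite.injective_iff_bijective.1 inj
  refine Finset.card_bijective p bij ?_
  intro i
  simp only [Finset.mem_filter, Finset.mem_univ, true_and]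
  exact h.con i (p i) (hp1 i) (nonroot i)

/-- The (symmetric, functional, total) relation of the sign-reversing involution. -/
def P {n : ℕ} (M M' : CNAT n) : Prop :=
  ∃ r c, Coloring M r c ∧
    ((∃ a b, FirstMix r a b ∧ ∀ i j, M'.dot i j = M.dot (Equiv.swap a b i) j) ∨
     ((∀ a b, ¬ FirstMix r a b) ∧
       ∃ a b, FirstMix c a b ∧ ∀ i j, M'.dot i j = M.dot i (Equiv.swap a b j)))

theorem P_total {n : ℕ} (hn : 1 < n) (hodd : Odd n) (M : CNAT n) : ∃ M', P M M' := by
  have hc := coloring_LR M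
  set r := LR M
  generalize (fun j : Fin n => (j : ℕ) = 0 ∨ ∃ i, M.dot i j = true ∧ r i) = c at hc
  by_cases h : ∃ a b, FirstMix r a b
  · obtain ⟨a, b, hm⟩ := h
    have hm' := hm
    obtain ⟨t, h1, h2, h3, h4⟩ := hm
    obtain ⟨M', hM'⟩ := exists_rowSwap M a b (by omega) (by omega) (fun j d1 d2 =>
      h3 ((hc.con a j d1 (by omega)).trans (hc.con b j d2 (by omega)).symm))
    exact ⟨M', r, c, hc, Or.inl ⟨a, b, hm', hM'⟩⟩
  · push Not at h
    have : ∃ a b, FirstMix c a b := by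
      by_contra hcon
      push Not at hcon
      have p1 := parity hodd r h ⟨0, by omega⟩ rfl
      have p2 := parity hodd c hcon ⟨0, by omega⟩ rfl
      rw [if_neg (hc.r0 _ rfl)] at p1
      rw [if_pos (hc.c0 _ rfl)] at p2
      rw [card_eq hn M hc] at p1
      omega
    obtain ⟨a, b, hm⟩ := this
    have hm' := hm
    obtain ⟨t, h1, h2, h3, h4⟩ := hm
    obtain ⟨M', hM'⟩ := exists_rowSwap (transp M) a b (by omega) (by omega) (fun j d1 d2 =>
      h3 ((hc.con j a d1 (by omega)).symm.trans (hc.con j b d2 (by omega))))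
    exact ⟨transp M', r, c, hc, Or.inr ⟨h, a, b, hm', fun i j => hM' j i⟩⟩

theorem P_symm {n : ℕ} {M M' : CNAT n} (h : P M M') : P M' M := by
  obtain ⟨r, c, hc, ⟨a, b, hm, hd⟩ | ⟨hno, a, b, hm, hd⟩⟩ := h
  · have hm' := hm
    obtain ⟨t, h1, h2, -, -⟩ := hm'
    have ha : (a : ℕ) ≠ 0 := by omega
    have hb : (b : ℕ) ≠ 0 := by omega
    refine ⟨fun i => r (Equiv.swap a b i), c, ⟨?_, hc.c0, ?_⟩, Or.inl ⟨a, b, hm.swap, ?_⟩⟩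
    · intro i hi
      exact hc.r0 _ ((swap_zero ha hb).2 hi)
    · intro i j d hne
      rw [hd] at d
      exact hc.con _ j d (by rwa [swap_zero ha hb])
    · intro i j
      rw [hd, Equiv.swap_apply_self]
  · have hm' := hm
    obtain ⟨t, h1, h2, -, -⟩ := hm'
    have ha : (a : ℕ) ≠ 0 := by omega
    have hb : (b : ℕ) ≠ 0 := by omega
    refine ⟨r, fun j => c (Equiv.swap a b j), ⟨hc.r0, ?_, ?_⟩, Or.inr ⟨hno, a, b, hm.swap, ?_⟩⟩
    · intro i hi
      exact hc.c0 _ ((swap_zero ha hb).2 hi)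
    · intro i j d hne
      rw [hd] at d
      exact hc.con i _ d (by rwa [swap_zero ha hb])
    · intro i j
      rw [hd, Equiv.swap_apply_self]

theorem P_fun {n : ℕ} {M M1 M2 : CNAT n} (h1 : P M M1) (h2 : P M M2) : M1 = M2 := by
  obtain ⟨r, c, hc, h⟩ := h1
  obtain ⟨r', c', hc', h'⟩ := h2
  obtain ⟨rfl, rfl⟩ := hc.unique hc'
  rcases h with ⟨a, b, hm, hd⟩ | ⟨hno, a, b, hm, hd⟩ <;>
  rcases h' with ⟨a', b', hm', hd'⟩ | ⟨hno', a', b', hm', hd'⟩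
  · obtain ⟨rfl, rfl⟩ := hm.unique hm'
    exact dot_ext (fun i j => (hd i j).trans (hd' i j).symm)
  · exact absurd hm (hno' _ _)
  · exact absurd hm' (hno _ _)
  · obtain ⟨rfl, rfl⟩ := hm.unique hm'
    exact dot_ext (fun i j => (hd i j).trans (hd' i j).symm)

theorem P_det {n : ℕ} {M M' : CNAT n} (h : P M M') : cnatDet M' = - cnatDet M := by
  obtain ⟨r, c, hc, ⟨a, b, hm, hd⟩ | ⟨hno, a, b, hm, hd⟩⟩ := h
  · obtain ⟨t, h1, h2, -, -⟩ := hm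
    have hne : a ≠ b := by rintro rfl; omega
    have := Matrix.det_permute (Equiv.swap a b)
      (Matrix.of fun i j => if M.dot i j then (1 : ℤ) else 0)
    rw [Equiv.Perm.sign_swap hne] at this
    unfold cnatDet
    simp only [hd]
    simpa [Matrix.submatrix] using this
  · obtain ⟨t, h1, h2, -, -⟩ := hm
    have hne : a ≠ b := by rintro rfl; omega
    have := Matrix.det_permute' (Equiv.swap a b)
      (Matrix.of fun i j => if M.dot i j then (1 : ℤ) else 0)
    rw [Equiv.Perm.sign_swap hne] at this
    unfold cnatDet
    simp only [hd]
    simpa [Matrix.submatrix] using this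

theorem main {n : ℕ} (hn : 1 < n) (hodd : Odd n) : cnatA n = cnatB n := by
  choose f hf using P_total hn hodd
  have inv : Function.Involutive f := fun M => P_fun (hf (f M)) (P_symm (hf M))
  refine Nat.card_congr (Equiv.subtypeEquiv inv.toPerm ?_)
  intro M
  have := P_det (hf M)
  show _ ↔ cnatDet (f M) = -1
  rw [this]
  omega

end CNATProof

theorem cnat_odd_evenly_distributed (n : ℕ) (hn : 1 < n) (hodd : Odd n) :
    cnatA n = cnatB n ∧ (cnatA n : ℚ) = (cnatT n : ℚ) / 2 := by
  have h := CNATProof.main hn hodd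
  refine ⟨h, ?_⟩
  unfold cnatT
  rw [h]
  push_cast
  ring
end

section
/- For every even natural number n ≥ 2, the numbers of CNATs of size n with determinant 1 and −1 are given in terms of the total counts by A_n = (T_n + (−1)^{n/2} · T_{n/2}) / 2 and B_n = (T_n − (−1)^{n/2} · T_{n/2}) / 2. -/
open Finset

namespace CNAT

variable {n : ℕ}

theorem ext_dot {M N : CNAT n} (h : ∀ i j, M.dot i j = true ↔ N.dot i j = true) : M = N := by
  have : M.dot = N.dot := by
    funext i j
    exact Bool.eq_iff_iff.mpr (h i j)
  cases M; cases N; cases this; rfl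

noncomputable instance : Fintype (CNAT n) := by
  classical
  exact Fintype.ofInjective (fun M : CNAT n => M.dot) (by
    intro M N h
    apply ext_dot
    intro i j
    have heq : M.dot = N.dot := h
    rw [heq])

/-- The transposed CNAT. -/
def tr (M : CNAT n) : CNAT n where
  dot i j := M.dot j i
  root h := M.root h
  nonambiguous i j h h0 := by
    have := M.nonambiguous j i h (fun h' => h0 ⟨h'.2, h'.1⟩)
    rcases this with h1 | h1
    · exact Or.inr h1
    · exact Or.inl h1
  min_row := M.min_col
  min_col := M.min_row
  complete i j h := (M.complete j i h).symm

@[simp] theorem tr_dot (M : CNAT n) (i j : Fin n) : M.tr.dot i j = M.dot j i := rfl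

@[simp] theorem tr_tr (M : CNAT n) : M.tr.tr = M := ext_dot fun _ _ => Iff.rfl

theorem not_both (M : CNAT n) {i j i' j' : Fin n} (h : M.dot i j = true) (hi : i' < i)
    (h1 : M.dot i' j = true) (hj : j' < j) (h2 : M.dot i j' = true) : False := by
  have h0 : ¬((i : ℕ) = 0 ∧ (j : ℕ) = 0) := by
    intro h0
    have : (i' : ℕ) < i := hi
    omega
  rcases M.nonambiguous i j h h0 with h3 | h3
  · exact h3.2 ⟨_, hj, h2⟩
  · exact h3.2 ⟨_, hi, h1⟩

/-- leaves -/
def Leaf (M : CNAT n) (i j : Fin n) : Prop :=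
  M.dot i j = true ∧ ∀ j', j < j' → ¬ M.dot i j' = true

theorem leaf_iff (M : CNAT n) (i j : Fin n) :
    M.Leaf i j ↔ M.dot i j = true ∧ ∀ i', i < i' → ¬ M.dot i' j = true := by
  constructor
  · rintro ⟨h, h1⟩
    refine ⟨h, fun i' hi hd => ?_⟩
    obtain ⟨j', hj, hd'⟩ := (M.complete i j h).1 ⟨i', hi, hd⟩
    exact h1 j' hj hd'
  · rintro ⟨h, h1⟩
    refine ⟨h, fun i' hi hd => ?_⟩
    obtain ⟨j', hj, hd'⟩ := (M.complete i j h).2 ⟨i', hi, hd⟩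
    exact h1 j' hj hd'

theorem tr_leaf (M : CNAT n) (i j : Fin n) : M.tr.Leaf i j ↔ M.Leaf j i := by
  rw [leaf_iff M]; rfl

theorem exists_leaf (M : CNAT n) (i : Fin n) : ∃ j, M.Leaf i j := by
  obtain ⟨j0, h0⟩ := M.min_row i
  have hne : (univ.filter fun j => M.dot i j = true).Nonempty := ⟨j0, by simp [h0]⟩
  refine ⟨(univ.filter fun j => M.dot i j = true).max' hne, ?_, ?_⟩
  · have := Finset.max'_mem _ hne
    simpa using this
  · intro j' hj hd
    have := Finset.le_max' (univ.filter fun j => M.dot i j = true) j' (by simp [hd])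
    exact absurd hj (not_lt.mpr this)

theorem leaf_unique (M : CNAT n) {i j j' : Fin n} (h : M.Leaf i j) (h' : M.Leaf i j') : j = j' := by
  rcases lt_trichotomy j j' with h1 | h1 | h1
  · exact absurd h'.1 (h.2 _ h1)
  · exact h1
  · exact absurd h.1 (h'.2 _ h1)

theorem leaf_unique' (M : CNAT n) {i i' j : Fin n} (h : M.Leaf i j) (h' : M.Leaf i' j) : i = i' :=
  M.tr.leaf_unique ((M.tr_leaf j i).2 h) ((M.tr_leaf j i').2 h')

theorem exists_leaf_perm (M : CNAT n) : ∃ σ : Equiv.Perm (Fin n), ∀ i, M.Leaf i (σ i) := by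
  choose f hf using M.exists_leaf
  have hinj : Function.Injective f := by
    intro i i' h
    have h1 := hf i
    rw [h] at h1
    exact M.leaf_unique' h1 (hf i')
  exact ⟨Equiv.ofBijective f (Finite.injective_iff_bijective.mp hinj), hf⟩

/-- The matrix. -/
def mat (M : CNAT n) : Matrix (Fin n) (Fin n) ℤ :=
  Matrix.of fun i j => if M.dot i j then (1 : ℤ) else 0

theorem mat_apply (M : CNAT n) (i j : Fin n) : M.mat i j = if M.dot i j then (1 : ℤ) else 0 := rfl

theorem cnatDet_eq (M : CNAT n) : cnatDet M = M.mat.det := rfl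

theorem det_pm (M : CNAT n) : cnatDet M = 1 ∨ cnatDet M = -1 := by
  obtain ⟨σ, hσ⟩ := M.exists_leaf_perm
  have h1 : (M.mat.submatrix id σ).det = 1 := by
    rw [Matrix.det_of_isUpperTriangular]
    · apply Finset.prod_eq_one
      intro i _
      simp [mat_apply, (hσ i).1]
    · intro i k hik
      have hik : k < i := hik
      have := ((M.leaf_iff _ _).1 (hσ k)).2 i hik
      simp [mat_apply, this]
  rw [Matrix.det_permute'] at h1
  rw [cnatDet_eq]
  rcases Int.units_eq_one_or (Equiv.Perm.sign σ) with h | h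
  · left; simpa [h] using h1
  · right
    rw [h] at h1
    push_cast at h1
    linarith

theorem tr_det (M : CNAT n) : cnatDet M.tr = cnatDet M := by
  rw [cnatDet_eq, cnatDet_eq, ← Matrix.det_transpose]
  rfl

/-- even index -/
def ev {m : ℕ} (a : Fin m) : Fin (2 * m) := ⟨2 * a, by omega⟩
/-- odd index -/
def od {m : ℕ} (a : Fin m) : Fin (2 * m) := ⟨2 * a + 1, by omega⟩

theorem ev_or_od {m : ℕ} (i : Fin (2 * m)) : (∃ a : Fin m, i = ev a) ∨ ∃ a : Fin m, i = od a := by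
  rcases Nat.even_or_odd' (i : ℕ) with ⟨k, h | h⟩
  · left; exact ⟨⟨k, by omega⟩, Fin.ext h⟩
  · right; exact ⟨⟨k, by omega⟩, Fin.ext h⟩

variable {m : ℕ}

theorem ev_lt_ev (a b : Fin m) : ev a < ev b ↔ a < b := by
  simp only [ev, Fin.lt_def]; omega
theorem od_lt_od (a b : Fin m) : od a < od b ↔ a < b := by
  simp only [od, Fin.lt_def]; omega
theorem ev_lt_od (a b : Fin m) : ev a < od b ↔ a ≤ b := by
  simp only [ev, od, Fin.lt_def, Fin.le_def]; omega
theorem od_lt_ev (a b : Fin m) : od a < ev b ↔ a < b := by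
  simp only [ev, od, Fin.lt_def]; omega
theorem ev_inj {a b : Fin m} : ev a = ev b ↔ a = b := by
  simp only [ev, Fin.ext_iff]; omega
theorem od_inj {a b : Fin m} : od a = od b ↔ a = b := by
  simp only [od, Fin.ext_iff]; omega
theorem ev_ne_od (a b : Fin m) : ev a ≠ od b := by
  simp only [ev, od, ne_eq, Fin.ext_iff]; omega

/-- The two rows of pair `a` share a column. -/
def Share (M : CNAT (2 * m)) (a : Fin m) : Prop := ∃ c, M.dot (ev a) c = true ∧ M.dot (od a) c = true

theorem share_zero (M : CNAT (2 * m)) (a : Fin m) (ha : (a : ℕ) = 0) : M.Share a := by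
  have hne : (univ.filter fun j => M.dot (od a) j = true).Nonempty := by
    obtain ⟨j, h⟩ := M.min_row (od a)
    exact ⟨j, by simp [h]⟩
  set j := (univ.filter fun j => M.dot (od a) j = true).min' hne with hj
  have h1 : M.dot (od a) j = true := by
    have := Finset.min'_mem _ hne
    simpa using this
  have h2 : ¬ ∃ j', j' < j ∧ M.dot (od a) j' = true := by
    rintro ⟨j', hlt, hd⟩
    have := Finset.min'_le (univ.filter fun j => M.dot (od a) j = true) j' (by simp [hd])
    exact absurd hlt (not_lt.mpr this)
  have h3 := M.nonambiguous (od a) j h1 (by simp [od])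
  rcases h3 with ⟨⟨i', hi', hd⟩, _⟩ | ⟨h, _⟩
  · have : i' = ev a := by
      apply Fin.ext
      have : (i' : ℕ) < 2 * a + 1 := hi'
      simp only [ev]; omega
    subst this
    exact ⟨j, hd, h1⟩
  · exact absurd h h2

/-- the row swap -/
def sw (a : Fin m) : Equiv.Perm (Fin (2 * m)) := Equiv.swap (ev a) (od a)

theorem sw_sw (a : Fin m) (i : Fin (2 * m)) : sw a (sw a i) = i := Equiv.swap_apply_self _ _ _

theorem sw_ev (a : Fin m) : sw a (ev a) = od a := Equiv.swap_apply_left _ _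
theorem sw_od (a : Fin m) : sw a (od a) = ev a := Equiv.swap_apply_right _ _

theorem sw_val (a : Fin m) (i : Fin (2 * m)) :
    ((sw a i : Fin (2 * m)) : ℕ) = if (i : ℕ) = 2 * (a : ℕ) then 2 * (a : ℕ) + 1
      else if (i : ℕ) = 2 * (a : ℕ) + 1 then 2 * (a : ℕ) else (i : ℕ) := by
  unfold sw
  rw [Equiv.swap_apply_def]
  simp only [ev, od, Fin.ext_iff]
  split_ifs <;> simp

theorem sw_lt (a : Fin m) {i i' : Fin (2 * m)} (h : i < i') (hn : ¬ (i = ev a ∧ i' = od a)) :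
    sw a i < sw a i' := by
  rw [Fin.lt_def] at *
  rw [sw_val, sw_val]
  simp only [ev, od, Fin.ext_iff] at hn
  split_ifs <;> omega

theorem sw_col_lt (M : CNAT (2 * m)) {a : Fin m} (hs : ¬ M.Share a) {i i' j : Fin (2 * m)}
    (h1 : M.dot (sw a i) j = true) (h2 : M.dot (sw a i') j = true) :
    sw a i < sw a i' ↔ i < i' := by
  constructor
  · intro h
    have := sw_lt a h (by
      rintro ⟨h3, h4⟩
      rw [h3] at h1; rw [h4] at h2
      exact hs ⟨j, h1, h2⟩)
    rwa [sw_sw, sw_sw] at this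
  · intro h
    apply sw_lt a h
    rintro ⟨rfl, rfl⟩
    rw [sw_ev] at h1; rw [sw_od] at h2
    exact hs ⟨j, h2, h1⟩

theorem sw_zero {a : Fin m} (ha : (a : ℕ) ≠ 0) (i : Fin (2 * m)) :
    ((sw a i : Fin (2 * m)) : ℕ) = 0 ↔ (i : ℕ) = 0 := by
  rw [sw_val]
  by_cases h1 : (i : ℕ) = 2 * (a : ℕ)
  · rw [if_pos h1]; omega
  · rw [if_neg h1]
    by_cases h2 : (i : ℕ) = 2 * (a : ℕ) + 1
    · rw [if_pos h2]; omega
    · rw [if_neg h2]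

/-- The swapped CNAT -/
def swp (M : CNAT (2 * m)) (a : Fin m) (hs : ¬ M.Share a) : CNAT (2 * m) :=
  have ha : (a : ℕ) ≠ 0 := fun h => hs (M.share_zero a h)
  have key1 : ∀ i j, M.dot (sw a i) j = true →
      ((∃ i', i' < i ∧ M.dot (sw a i') j = true) ↔ ∃ i', i' < sw a i ∧ M.dot i' j = true) := by
    intro i j h
    constructor
    · rintro ⟨i', hl, hd⟩
      exact ⟨sw a i', (M.sw_col_lt hs hd h).2 hl, hd⟩
    · rintro ⟨i', hl, hd⟩
      refine ⟨sw a i', ?_, by rwa [sw_sw]⟩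
      exact (M.sw_col_lt hs (by rwa [sw_sw]) h).1 (by rwa [sw_sw])
  have key2 : ∀ i j, M.dot (sw a i) j = true →
      ((∃ i', i < i' ∧ M.dot (sw a i') j = true) ↔ ∃ i', sw a i < i' ∧ M.dot i' j = true) := by
    intro i j h
    constructor
    · rintro ⟨i', hl, hd⟩
      exact ⟨sw a i', (M.sw_col_lt hs h hd).2 hl, hd⟩
    · rintro ⟨i', hl, hd⟩
      refine ⟨sw a i', ?_, by rwa [sw_sw]⟩
      exact (M.sw_col_lt hs h (by rwa [sw_sw])).1 (by rwa [sw_sw])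
  { dot := fun i j => M.dot (sw a i) j
    root := by
      intro h
      have : sw a ⟨0, h⟩ = ⟨0, h⟩ := Fin.ext ((sw_zero ha _).2 rfl)
      rw [this]; exact M.root h
    nonambiguous := by
      intro i j h h0
      rw [key1 i j h]
      exact M.nonambiguous (sw a i) j h (by rwa [sw_zero ha])
    min_row := fun i => M.min_row _
    min_col := fun j => by
      obtain ⟨i, h⟩ := M.min_col j
      exact ⟨sw a i, by rwa [sw_sw]⟩
    complete := by
      intro i j h
      rw [key2 i j h]
      exact M.complete (sw a i) j h }

@[simp] theorem swp_dot (M : CNAT (2 * m)) (a : Fin m) (hs : ¬ M.Share a) (i j) :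
    (M.swp a hs).dot i j = M.dot (sw a i) j := rfl

theorem swp_det (M : CNAT (2 * m)) (a : Fin m) (hs : ¬ M.Share a) :
    cnatDet (M.swp a hs) = - cnatDet M := by
  have : (M.swp a hs).mat = M.mat.submatrix (sw a) id := rfl
  rw [cnatDet_eq, cnatDet_eq, this, Matrix.det_permute]
  unfold sw
  rw [Equiv.Perm.sign_swap (ev_ne_od a a)]
  simp

theorem swp_share_self (M : CNAT (2 * m)) (a : Fin m) (hs : ¬ M.Share a) : ¬ (M.swp a hs).Share a := by
  rintro ⟨c, h1, h2⟩
  rw [swp_dot, sw_ev] at h1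
  rw [swp_dot, sw_od] at h2
  exact hs ⟨c, h2, h1⟩

theorem swp_swp (M : CNAT (2 * m)) (a : Fin m) (hs : ¬ M.Share a) :
    (M.swp a hs).swp a (M.swp_share_self a hs) = M := by
  apply ext_dot
  intro i j
  simp [sw_sw]

theorem swp_share_ne (M : CNAT (2 * m)) (a b : Fin m) (hs : ¬ M.Share a) (hab : b ≠ a) :
    (M.swp a hs).Share b ↔ M.Share b := by
  have h1 : sw a (ev b) = ev b :=
    Equiv.swap_apply_of_ne_of_ne (fun h => hab (ev_inj.1 h)) (ev_ne_od _ _)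
  have h2 : sw a (od b) = od b :=
    Equiv.swap_apply_of_ne_of_ne (ev_ne_od _ _).symm (fun h => hab (od_inj.1 h))
  simp only [Share, swp_dot, h1, h2]

theorem swp_share_tr (M : CNAT (2 * m)) (a b : Fin m) (hs : ¬ M.Share a) :
    (M.swp a hs).tr.Share b ↔ M.tr.Share b := by
  simp only [Share, tr_dot, swp_dot]
  exact (sw a).exists_congr_left.trans (by simp [sw, Equiv.symm_swap, Equiv.swap_apply_self])

open Classical in
theorem step (Q : CNAT (2 * m) → Prop) [DecidablePred Q] (a : Fin m)
    (hQ : ∀ M, ∀ hs : ¬ M.Share a, Q M → Q (M.swp a hs)) :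
    ∑ M : CNAT (2 * m) with Q M, cnatDet M = ∑ M : CNAT (2 * m) with (Q M ∧ M.Share a), cnatDet M := by
  have h0 : ∑ M : CNAT (2 * m) with (Q M ∧ ¬ M.Share a), cnatDet M = 0 := by
    refine Finset.sum_involution
      (fun M hM => M.swp a (Finset.mem_filter.1 hM).2.2) ?_ ?_ ?_ ?_
    · intro M hM
      rw [swp_det]; ring
    · intro M hM hne heq
      have := M.swp_det a (Finset.mem_filter.1 hM).2.2
      rw [heq] at this
      omega
    · intro M hM
      simp only [Finset.mem_filter, Finset.mem_univ, true_and] at hM ⊢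
      exact ⟨hQ M hM.2 hM.1, M.swp_share_self a hM.2⟩
    · intro M hM
      exact M.swp_swp a _
  rw [← Finset.sum_filter_add_sum_filter_not _ (fun M => M.Share a), Finset.filter_filter,
    Finset.filter_filter, h0, add_zero]

open Classical in
theorem steps (Q : CNAT (2 * m) → Prop) [DecidablePred Q]
    (hQ : ∀ a, ∀ M, ∀ hs : ¬ M.Share a, Q M → Q (M.swp a hs)) (k : ℕ) :
    ∑ M : CNAT (2 * m) with Q M, cnatDet M
      = ∑ M : CNAT (2 * m) with (Q M ∧ ∀ a : Fin m, (a : ℕ) < k → M.Share a), cnatDet M := by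
  induction k with
  | zero => simp
  | succ k ih =>
    rw [ih]
    by_cases hk : k < m
    · rw [step _ ⟨k, hk⟩]
      · apply Finset.sum_congr _ (fun _ _ => rfl)
        ext M
        simp only [Finset.mem_filter, Finset.mem_univ, true_and]
        constructor
        · rintro ⟨⟨h1, h2⟩, h3⟩
          refine ⟨h1, fun a ha => ?_⟩
          rcases Nat.lt_succ_iff_lt_or_eq.1 ha with h | h
          · exact h2 a h
          · have : a = ⟨k, hk⟩ := Fin.ext h
            rw [this]; exact h3
        · rintro ⟨h1, h2⟩
          exact ⟨⟨h1, fun a ha => h2 a (by omega)⟩, h2 _ (Nat.lt_succ_self k)⟩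
      · rintro M hs ⟨h1, h2⟩
        refine ⟨hQ _ M hs h1, fun a ha => ?_⟩
        rw [swp_share_ne]
        · exact h2 a ha
        · rintro rfl
          simp at ha
    · apply Finset.sum_congr _ (fun _ _ => rfl)
      ext M
      simp only [Finset.mem_filter, Finset.mem_univ, true_and]
      refine and_congr_right fun _ => forall_congr' fun a => ?_
      have : (a : ℕ) < k := by omega
      have : (a : ℕ) < k + 1 := by omega
      simp [*]

/-- Fixed CNATs. -/
def Fixed (M : CNAT (2 * m)) : Prop := (∀ a, M.Share a) ∧ ∀ a, M.tr.Share a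

open Classical in
theorem sum_fixed : ∑ M : CNAT (2 * m), cnatDet M = ∑ M : CNAT (2 * m) with M.Fixed, cnatDet M := by
  have h1 : ∑ M : CNAT (2 * m), cnatDet M
      = ∑ M : CNAT (2 * m) with (∀ a, M.Share a), cnatDet M := by
    have := steps (m := m) (fun _ => True) (fun _ _ _ _ => trivial) m
    simpa using this
  have h2 : ∑ M : CNAT (2 * m) with (∀ a, M.Share a), cnatDet M
      = ∑ M : CNAT (2 * m) with (∀ a, M.tr.Share a), cnatDet M := by
    apply Finset.sum_nbij' tr tr <;> simp [tr_det]
  have h3 := steps (m := m) (fun M => ∀ a, M.tr.Share a)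
    (fun a M hs h b => (M.swp_share_tr a b hs).2 (h b)) m
  rw [h1, h2, h3]
  apply Finset.sum_congr _ (fun _ _ => rfl)
  ext M
  rw [Finset.mem_filter, Finset.mem_filter]
  refine and_congr_right fun _ => ?_
  constructor
  · rintro ⟨h, h'⟩; exact ⟨fun a => h' a a.2, h⟩
  · rintro ⟨h, h'⟩; exact ⟨h', fun a _ => h a⟩

theorem Fixed.tr {M : CNAT (2 * m)} (h : M.Fixed) : M.tr.Fixed := ⟨h.2, by simpa using h.1⟩

theorem two_dots {M : CNAT (2 * m)} (h : M.Fixed) {i j j' : Fin (2 * m)} (hj : j < j')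
    (h1 : M.dot i j = true) (h2 : M.dot i j' = true) :
    ∃ b : Fin m, M.dot i (ev b) = true ∧ M.Leaf i (od b) := by
  obtain ⟨l, hl⟩ := M.exists_leaf i
  have hjl : j < l := lt_of_lt_of_le hj (not_lt.1 fun hlt => hl.2 _ hlt h2)
  have hsing : ∀ i', M.dot i' l = true → i' = i := by
    intro i' hd
    rcases lt_trichotomy i' i with h3 | h3 | h3
    · exact (M.not_both hl.1 h3 hd hjl h1).elim
    · exact h3
    · exact absurd hd (((M.leaf_iff _ _).1 hl).2 _ h3)
  rcases ev_or_od l with ⟨b, rfl⟩ | ⟨b, rfl⟩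
  · obtain ⟨r, hr1, hr2⟩ := h.2 b
    simp only [tr_dot] at hr1 hr2
    rw [hsing r hr1] at hr2
    exact absurd hr2 (hl.2 _ ((ev_lt_od b b).2 le_rfl))
  · obtain ⟨r, hr1, hr2⟩ := h.2 b
    simp only [tr_dot] at hr1 hr2
    rw [hsing r hr2] at hr1
    exact ⟨b, hr1, hl⟩

/-- uniqueness of the shared row of a column pair. -/
theorem share_unique (M : CNAT (2 * m)) {b : Fin m} {r r' : Fin (2 * m)}
    (h1 : M.dot r (ev b) = true) (h2 : M.dot r (od b) = true)
    (h1' : M.dot r' (ev b) = true) (h2' : M.dot r' (od b) = true) : r = r' := by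
  have hb := (ev_lt_od b b).2 le_rfl
  rcases lt_trichotomy r r' with h | h | h
  · exact (M.not_both h2' h h2 hb h1').elim
  · exact h
  · exact (M.not_both h2 h h2' hb h1).elim

theorem exists_beta {M : CNAT (2 * m)} (h : M.Fixed) :
    ∃ β : Equiv.Perm (Fin m), ∀ a, M.dot (ev a) (ev (β a)) = true ∧ M.Leaf (ev a) (od (β a)) := by
  have h1 : ∀ a : Fin m, ∃ b : Fin m, M.dot (ev a) (ev b) = true ∧ M.Leaf (ev a) (od b) := by
    intro a
    obtain ⟨c, hc1, hc2⟩ := h.1 a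
    obtain ⟨j', hj, hd⟩ := (M.complete _ _ hc1).1 ⟨od a, (ev_lt_od a a).2 le_rfl, hc2⟩
    exact two_dots h hj hc1 hd
  choose β hβ using h1
  have hinj : Function.Injective β := by
    intro a a' hh
    have h2 := hβ a
    rw [hh] at h2
    exact ev_inj.1 (M.share_unique h2.1 h2.2.1 (hβ a').1 (hβ a').2.1)
  exact ⟨Equiv.ofBijective β (Finite.injective_iff_bijective.mp hinj), hβ⟩

theorem odd_row_sing {M : CNAT (2 * m)} (h : M.Fixed) {a : Fin m} {j j' : Fin (2 * m)}
    (h1 : M.dot (od a) j = true) (h2 : M.dot (od a) j' = true) : j = j' := by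
  by_contra hne
  have : ∃ b : Fin m, M.dot (od a) (ev b) = true ∧ M.Leaf (od a) (od b) := by
    rcases lt_or_gt_of_ne hne with hl | hl
    · exact two_dots h hl h1 h2
    · exact two_dots h hl h2 h1
  obtain ⟨b, hb1, hb2⟩ := this
  obtain ⟨β, hβ⟩ := exists_beta h
  have h3 := hβ (β.symm b)
  rw [Equiv.apply_symm_apply] at h3
  exact ev_ne_od _ _ (M.share_unique h3.1 h3.2.1 hb1 hb2.1)

theorem odd_col_sing {M : CNAT (2 * m)} (h : M.Fixed) {a : Fin m} {j j' : Fin (2 * m)}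
    (h1 : M.dot j (od a) = true) (h2 : M.dot j' (od a) = true) : j = j' :=
  odd_row_sing (M := M.tr) h.tr (a := a) h1 h2

theorem exists_psi {M : CNAT (2 * m)} (h : M.Fixed) :
    ∃ ψ : Equiv.Perm (Fin m), ∀ a, M.dot (ev a) (ev (ψ a)) = true ∧
      M.dot (ev a) (od (ψ a)) = true ∧ M.dot (od a) (ev (ψ a)) = true := by
  obtain ⟨β, hβ⟩ := exists_beta h
  obtain ⟨γ, hγ⟩ := exists_beta h.tr
  have hle : ∀ a, γ.symm a ≤ β a := by
    intro a
    have h3 := hγ (γ.symm a)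
    rw [Equiv.apply_symm_apply, tr_leaf] at h3
    have h4 : M.dot (ev a) (ev (γ.symm a)) = true := h3.1
    have h5 := h3.2.1
    obtain ⟨j', hj, hd⟩ := (M.complete _ _ h4).1 ⟨od a, (ev_lt_od a a).2 le_rfl, h5⟩
    have h6 : j' ≤ od (β a) := not_lt.1 fun hlt => (hβ a).2.2 _ hlt hd
    exact (ev_lt_od _ _).1 (lt_of_lt_of_le hj h6)
  have hsum : ∑ a, ((γ.symm a : Fin m) : ℕ) = ∑ a, ((β a : Fin m) : ℕ) := by
    rw [Equiv.sum_comp γ.symm (fun x : Fin m => (x : ℕ)), Equiv.sum_comp β (fun x : Fin m => (x : ℕ))]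
  have heq := (Finset.sum_eq_sum_iff_of_le (fun a _ => Fin.le_def.1 (hle a))).1 hsum
  refine ⟨β, fun a => ⟨(hβ a).1, (hβ a).2.1, ?_⟩⟩
  have h7 : γ.symm a = β a := Fin.ext (heq a (Finset.mem_univ a))
  have h3 := hγ (γ.symm a)
  rw [Equiv.apply_symm_apply, tr_leaf, h7] at h3
  exact h3.2.1

/-- Full structure of a fixed CNAT. -/
theorem fixed_structure {M : CNAT (2 * m)} (h : M.Fixed) :
    ∃ ψ : Equiv.Perm (Fin m), (∀ a, M.dot (ev a) (ev (ψ a)) = true) ∧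
      (∀ a b, M.dot (ev a) (od b) = true ↔ b = ψ a) ∧
      (∀ a b, M.dot (od a) (ev b) = true ↔ b = ψ a) ∧
      (∀ a b, ¬ M.dot (od a) (od b) = true) ∧
      (∀ a b, M.dot (ev a) (ev b) = true → b ≤ ψ a) ∧
      (∀ a b, M.dot (ev a) (ev b) = true → a ≤ ψ.symm b) := by
  obtain ⟨ψ, hψ⟩ := exists_psi h
  have h2 : ∀ a b, M.dot (ev a) (od b) = true ↔ b = ψ a := by
    intro a b
    constructor
    · intro hd
      have h3 := (hψ (ψ.symm b)).2.1
      rw [Equiv.apply_symm_apply] at h3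
      have := ev_inj.1 (odd_col_sing h hd h3)
      rw [this, Equiv.apply_symm_apply]
    · rintro rfl; exact (hψ a).2.1
  have h3 : ∀ a b, M.dot (od a) (ev b) = true ↔ b = ψ a := by
    intro a b
    constructor
    · intro hd
      exact ev_inj.1 (odd_row_sing h hd (hψ a).2.2)
    · rintro rfl; exact (hψ a).2.2
  refine ⟨ψ, fun a => (hψ a).1, h2, h3, ?_, ?_, ?_⟩
  · intro a b hd
    exact ev_ne_od _ _ (odd_row_sing h (hψ a).2.2 hd)
  · intro a b hd
    by_contra hlt
    rw [not_le] at hlt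
    obtain ⟨i', hi, hd'⟩ := (M.complete _ _ (hψ a).2.1).2 ⟨ev b, (od_lt_ev _ _).2 hlt, hd⟩
    exact hi.ne (odd_col_sing h (hψ a).2.1 hd')
  · intro a b hd
    by_contra hlt
    rw [not_le] at hlt
    have h5 := (hψ (ψ.symm b)).2.2
    rw [Equiv.apply_symm_apply] at h5
    obtain ⟨i', hi, hd'⟩ := (M.complete _ _ h5).1 ⟨ev a, (od_lt_ev _ _).2 hlt, hd⟩
    exact hi.ne (odd_row_sing h h5 hd')

theorem exists_idx {P : Fin (2 * m) → Prop} : (∃ i, P i) ↔ (∃ a, P (ev a)) ∨ ∃ a, P (od a) := by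
  constructor
  · rintro ⟨i, hi⟩
    rcases ev_or_od i with ⟨a, rfl⟩ | ⟨a, rfl⟩
    · exact Or.inl ⟨a, hi⟩
    · exact Or.inr ⟨a, hi⟩
  · rintro (⟨a, h⟩ | ⟨a, h⟩) <;> exact ⟨_, h⟩

/-- Halving of a fixed CNAT. -/
def halve (M : CNAT (2 * m)) (h : M.Fixed) : CNAT m where
  dot a b := M.dot (ev a) (ev b)
  root h0 := M.root (by omega)
  nonambiguous := by
    intro a b hd h0
    obtain ⟨ψ, s1, s2, s3, s4, s5, s6⟩ := fixed_structure h
    have := M.nonambiguous (ev a) (ev b) hd (by simp only [ev]; omega)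
    rw [exists_idx, exists_idx] at this
    simp only [ev_lt_ev, od_lt_ev, s2, s3] at this
    have e1 : ((∃ a', a' < a ∧ M.dot (ev a') (ev b) = true) ∨ ∃ a', a' < a ∧ b = ψ a') ↔
        ∃ a', a' < a ∧ M.dot (ev a') (ev b) = true := by
      refine or_iff_left_of_imp ?_
      rintro ⟨a', ha, rfl⟩
      exact ⟨a', ha, s1 a'⟩
    have e2 : ((∃ b', b' < b ∧ M.dot (ev a) (ev b') = true) ∨ ∃ b', b' < b ∧ b' = ψ a) ↔
        ∃ b', b' < b ∧ M.dot (ev a) (ev b') = true := by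
      refine or_iff_left_of_imp ?_
      rintro ⟨b', hb, rfl⟩
      exact ⟨_, hb, s1 a⟩
    rwa [e1, e2] at this
  min_row a := by
    obtain ⟨ψ, s1, -⟩ := fixed_structure h
    exact ⟨_, s1 a⟩
  min_col b := by
    obtain ⟨ψ, s1, -⟩ := fixed_structure h
    exact ⟨ψ.symm b, by simpa using s1 (ψ.symm b)⟩
  complete := by
    intro a b hd
    obtain ⟨ψ, s1, s2, s3, s4, s5, s6⟩ := fixed_structure h
    have e1 : (∃ a', a < a' ∧ M.dot (ev a') (ev b) = true) ↔ b ≠ ψ a := by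
      constructor
      · rintro ⟨a', ha, hd'⟩ rfl
        have := s6 _ _ hd'
        rw [Equiv.symm_apply_apply] at this
        exact absurd ha (not_lt.2 this)
      · intro hne
        refine ⟨ψ.symm b, lt_of_le_of_ne (s6 _ _ hd) ?_, by simpa using s1 (ψ.symm b)⟩
        rintro rfl
        simp at hne
    have e2 : (∃ b', b < b' ∧ M.dot (ev a) (ev b') = true) ↔ b ≠ ψ a := by
      constructor
      · rintro ⟨b', ha, hd'⟩ rfl
        exact absurd ha (not_lt.2 (s5 _ _ hd'))
      · intro hne
        exact ⟨ψ a, lt_of_le_of_ne (s5 _ _ hd) hne, s1 a⟩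
    rw [e1, e2]

/-- half index -/
def hf (i : Fin (2 * m)) : Fin m := ⟨(i : ℕ) / 2, by omega⟩

theorem hf_ev (a : Fin m) : hf (ev a) = a := by
  simp only [hf, ev, Fin.ext_iff]; omega
theorem hf_od (a : Fin m) : hf (od a) = a := by
  simp only [hf, od, Fin.ext_iff]; omega
theorem ev_mod (a : Fin m) : ((ev a : Fin (2 * m)) : ℕ) % 2 = 0 := by
  simp only [ev]; omega
theorem od_mod (a : Fin m) : ((od a : Fin (2 * m)) : ℕ) % 2 = 1 := by
  simp only [od]; omega

open Classical in
/-- doubled dots -/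
noncomputable def dd (N : CNAT m) (i j : Fin (2 * m)) : Bool :=
  if (i : ℕ) % 2 = 0 then
    if (j : ℕ) % 2 = 0 then N.dot (hf i) (hf j) else decide (N.Leaf (hf i) (hf j))
  else
    if (j : ℕ) % 2 = 0 then decide (N.Leaf (hf i) (hf j)) else false

theorem dd_ee (N : CNAT m) (a b : Fin m) : N.dd (ev a) (ev b) = N.dot a b := by
  simp [dd, hf_ev, ev_mod]
theorem dd_eo (N : CNAT m) (a b : Fin m) : N.dd (ev a) (od b) = true ↔ N.Leaf a b := by
  simp [dd, hf_ev, hf_od, ev_mod, od_mod]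
theorem dd_oe (N : CNAT m) (a b : Fin m) : N.dd (od a) (ev b) = true ↔ N.Leaf a b := by
  simp [dd, hf_ev, hf_od, ev_mod, od_mod]
theorem dd_oo (N : CNAT m) (a b : Fin m) : ¬ N.dd (od a) (od b) = true := by
  simp [dd, od_mod]

/-- doubled CNAT -/
noncomputable def dbl (N : CNAT m) : CNAT (2 * m) where
  dot := N.dd
  root h := by
    have h0 : 0 < m := by omega
    have := N.dd_ee ⟨0, h0⟩ ⟨0, h0⟩
    rw [N.root h0] at this
    exact this
  nonambiguous := by
    intro i j hd h0
    rw [exists_idx, exists_idx]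
    rcases ev_or_od i with ⟨a, rfl⟩ | ⟨a, rfl⟩ <;> rcases ev_or_od j with ⟨b, rfl⟩ | ⟨b, rfl⟩
    · simp only [ev_lt_ev, od_lt_ev, dd_ee, dd_oe, dd_eo] at hd ⊢
      have := N.nonambiguous a b hd (by simp only [ev] at h0; omega)
      have e1 : ((∃ a', a' < a ∧ N.dot a' b = true) ∨ ∃ a', a' < a ∧ N.Leaf a' b) ↔
          ∃ a', a' < a ∧ N.dot a' b = true := by
        refine or_iff_left_of_imp ?_
        rintro ⟨a', ha, hl⟩
        exact ⟨a', ha, hl.1⟩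
      have e2 : ((∃ b', b' < b ∧ N.dot a b' = true) ∨ ∃ b', b' < b ∧ N.Leaf a b') ↔
          ∃ b', b' < b ∧ N.dot a b' = true := by
        refine or_iff_left_of_imp ?_
        rintro ⟨b', ha, hl⟩
        exact ⟨b', ha, hl.1⟩
      rwa [e1, e2]
    · simp only [ev_lt_ev, od_lt_ev, ev_lt_od, od_lt_od, dd_ee, dd_oe, dd_eo, dd_oo] at hd ⊢
      right
      refine ⟨Or.inl ⟨b, le_rfl, hd.1⟩, ?_⟩
      rintro (⟨a', ha, hl⟩ | ⟨a', ha, hl⟩)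
      · exact ha.ne (N.leaf_unique' hl hd)
      · exact Bool.false_ne_true hl
    · simp only [ev_lt_ev, od_lt_ev, ev_lt_od, od_lt_od, dd_ee, dd_oe, dd_eo, dd_oo] at hd ⊢
      left
      refine ⟨Or.inl ⟨a, le_rfl, hd.1⟩, ?_⟩
      rintro (⟨a', ha, hl⟩ | ⟨a', ha, hl⟩)
      · exact ha.ne (N.leaf_unique hl hd)
      · exact Bool.false_ne_true hl
    · exact absurd hd (N.dd_oo a b)
  min_row i := by
    rcases ev_or_od i with ⟨a, rfl⟩ | ⟨a, rfl⟩ <;> obtain ⟨b, hb⟩ := N.exists_leaf a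
    · exact ⟨od b, (N.dd_eo a b).2 hb⟩
    · exact ⟨ev b, (N.dd_oe a b).2 hb⟩
  min_col j := by
    rcases ev_or_od j with ⟨a, rfl⟩ | ⟨a, rfl⟩ <;> obtain ⟨b, hb⟩ := N.tr.exists_leaf a <;>
      rw [tr_leaf] at hb
    · exact ⟨od b, (N.dd_oe b a).2 hb⟩
    · exact ⟨ev b, (N.dd_eo b a).2 hb⟩
  complete := by
    intro i j hd
    rw [exists_idx, exists_idx]
    rcases ev_or_od i with ⟨a, rfl⟩ | ⟨a, rfl⟩ <;> rcases ev_or_od j with ⟨b, rfl⟩ | ⟨b, rfl⟩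
    · simp only [ev_lt_ev, ev_lt_od, dd_ee, dd_oe, dd_eo] at hd ⊢
      obtain ⟨bl, hbl⟩ := N.exists_leaf a
      obtain ⟨al, hal⟩ := N.tr.exists_leaf b
      rw [tr_leaf] at hal
      have h1 : a ≤ al := not_lt.1 fun hlt => ((N.leaf_iff _ _).1 hal).2 _ hlt hd
      have h2 : b ≤ bl := not_lt.1 fun hlt => hbl.2 _ hlt hd
      exact iff_of_true (Or.inr ⟨al, h1, hal⟩) (Or.inr ⟨bl, h2, hbl⟩)
    · simp only [ev_lt_ev, ev_lt_od, od_lt_ev, od_lt_od, dd_ee, dd_oe, dd_eo, dd_oo] at hd ⊢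
      refine iff_of_false ?_ ?_
      · rintro (⟨a', ha, hl⟩ | ⟨a', ha, hl⟩)
        · exact ha.ne' (N.leaf_unique' hl hd)
        · exact Bool.false_ne_true hl
      · rintro (⟨a', ha, hl⟩ | ⟨a', ha, hl⟩)
        · exact hd.2 _ ha hl
        · exact ha.ne' (N.leaf_unique hl hd)
    · simp only [ev_lt_ev, ev_lt_od, od_lt_ev, od_lt_od, dd_ee, dd_oe, dd_eo, dd_oo] at hd ⊢
      refine iff_of_false ?_ ?_
      · rintro (⟨a', ha, hl⟩ | ⟨a', ha, hl⟩)
        · exact ((N.leaf_iff _ _).1 hd).2 _ ha hl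
        · exact ha.ne' (N.leaf_unique' hl hd)
      · rintro (⟨a', ha, hl⟩ | ⟨a', ha, hl⟩)
        · exact ha.ne' (N.leaf_unique hl hd)
        · exact Bool.false_ne_true hl
    · exact absurd hd (N.dd_oo a b)

theorem dbl_dot (N : CNAT m) (i j : Fin (2 * m)) : N.dbl.dot i j = N.dd i j := rfl

theorem dbl_fixed (N : CNAT m) : N.dbl.Fixed := by
  constructor
  · intro a
    obtain ⟨b, hb⟩ := N.exists_leaf a
    exact ⟨ev b, (N.dd_ee a b).trans hb.1, (N.dd_oe a b).2 hb⟩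
  · intro b
    obtain ⟨a, hb⟩ := N.tr.exists_leaf b
    rw [tr_leaf] at hb
    exact ⟨ev a, (N.dd_ee a b).trans hb.1, (N.dd_eo a b).2 hb⟩

theorem dbl_injective : Function.Injective (dbl : CNAT m → CNAT (2 * m)) := by
  intro N N' h
  apply ext_dot
  intro a b
  rw [← dd_ee N, ← dd_ee N', ← dbl_dot, ← dbl_dot, h]

theorem dbl_halve (M : CNAT (2 * m)) (h : M.Fixed) : (M.halve h).dbl = M := by
  obtain ⟨ψ, s1, s2, s3, s4, s5, s6⟩ := fixed_structure h
  have hl : ∀ a b, (M.halve h).Leaf a b ↔ b = ψ a := by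
    have h0 : ∀ a, (M.halve h).Leaf a (ψ a) := fun a =>
      ⟨s1 a, fun b hb hd => absurd hb (not_lt.2 (s5 _ _ hd))⟩
    intro a b
    constructor
    · intro hb; exact leaf_unique _ hb (h0 a)
    · rintro rfl; exact h0 a
  apply ext_dot
  intro i j
  rw [dbl_dot]
  rcases ev_or_od i with ⟨a, rfl⟩ | ⟨a, rfl⟩ <;> rcases ev_or_od j with ⟨b, rfl⟩ | ⟨b, rfl⟩
  · rw [dd_ee]; rfl
  · rw [dd_eo, hl, s2]
  · rw [dd_oe, hl, s3]
  · exact iff_of_false (dd_oo _ _ _) (s4 _ _)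

/-- index equivalence -/
noncomputable def idx (m : ℕ) : Fin m ⊕ Fin m ≃ Fin (2 * m) :=
  Equiv.ofBijective (Sum.elim ev od) (by
    constructor
    · rintro (a | a) (b | b) h
      · exact congrArg _ (ev_inj.1 h)
      · exact absurd h (ev_ne_od _ _)
      · exact absurd h.symm (ev_ne_od _ _)
      · exact congrArg _ (od_inj.1 h)
    · intro i
      rcases ev_or_od i with ⟨a, rfl⟩ | ⟨a, rfl⟩
      · exact ⟨Sum.inl a, rfl⟩
      · exact ⟨Sum.inr a, rfl⟩)

theorem idx_inl (a : Fin m) : idx m (Sum.inl a) = ev a := rfl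
theorem idx_inr (a : Fin m) : idx m (Sum.inr a) = od a := rfl

theorem det_anti (A L : Matrix (Fin m) (Fin m) ℤ) :
    (Matrix.fromBlocks A L L 0).det = (-1) ^ m * L.det ^ 2 := by
  have h : Matrix.fromBlocks A L L 0 =
      Matrix.fromBlocks L A 0 L * (Matrix.fromBlocks 1 1 0 1 * Matrix.fromBlocks (-1) 0 1 1
        * Matrix.fromBlocks 1 (-1) 0 1) := by
    simp [Matrix.fromBlocks_multiply]
  rw [h]
  simp only [Matrix.det_mul, Matrix.det_fromBlocks_zero₂₁, Matrix.det_fromBlocks_zero₁₂, Matrix.det_one,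
    Matrix.det_neg, Fintype.card_fin]
  ring

theorem dbl_det (N : CNAT m) : cnatDet N.dbl = (-1) ^ m := by
  obtain ⟨σ, hσ⟩ := N.exists_leaf_perm
  have hL : ∀ a b, N.Leaf a b ↔ σ a = b := fun a b =>
    ⟨fun h => N.leaf_unique (hσ a) h, by rintro rfl; exact hσ a⟩
  have h1 : N.dbl.mat.submatrix (idx m) (idx m) =
      Matrix.fromBlocks N.mat (σ.permMatrix ℤ) (σ.permMatrix ℤ) 0 := by
    ext i j
    rcases i with a | a <;> rcases j with b | b <;>
      simp [idx_inl, idx_inr, mat_apply, dbl_dot, dd_ee, dd_eo, dd_oe, dd_oo, hL, Equiv.Perm.permMatrix,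
        PEquiv.toMatrix_apply]
  rw [cnatDet_eq, ← Matrix.det_submatrix_equiv_self (idx m), h1, det_anti, Matrix.det_permutation]
  rcases Int.units_eq_one_or (Equiv.Perm.sign σ) with h | h <;> simp [h]

theorem sum_det : ∑ M : CNAT (2 * m), cnatDet M = (-1) ^ m * (Fintype.card (CNAT m) : ℤ) := by
  classical
  rw [sum_fixed]
  have : ∑ N : CNAT m, ((-1) ^ m : ℤ) = ∑ M : CNAT (2 * m) with M.Fixed, cnatDet M := by
    apply Finset.sum_bij (fun N _ => N.dbl)
    · intro N _; simpa using N.dbl_fixed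
    · intro N _ N' _ h; exact dbl_injective h
    · intro M hM
      exact ⟨M.halve (by simpa using hM), Finset.mem_univ _, dbl_halve _ _⟩
    · intro N _; exact N.dbl_det.symm
  rw [← this]
  simp [mul_comm]

theorem cnatT_eq : cnatT n = Fintype.card (CNAT n) := by
  classical
  rw [cnatT, cnatA, cnatB, Nat.card_eq_fintype_card, Nat.card_eq_fintype_card,
    Fintype.card_subtype, Fintype.card_subtype, ← Finset.card_union_of_disjoint]
  · rw [← Finset.filter_or, Finset.filter_true_of_mem (fun M _ => M.det_pm), Finset.card_univ]
  · rw [Finset.disjoint_filter]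
    intro M _ h; omega

theorem sub_eq : (cnatA n : ℤ) - cnatB n = ∑ M : CNAT n, cnatDet M := by
  classical
  have h : ∀ M : CNAT n, cnatDet M =
      (if cnatDet M = 1 then 1 else 0) - (if cnatDet M = -1 then 1 else 0) := by
    intro M
    rcases M.det_pm with h | h <;> simp [h]
  rw [Finset.sum_congr rfl (fun M _ => h M), Finset.sum_sub_distrib, Finset.sum_boole,
    Finset.sum_boole, cnatA, cnatB, Nat.card_eq_fintype_card, Nat.card_eq_fintype_card,
    Fintype.card_subtype, Fintype.card_subtype]

end CNAT

theorem cnat_even_counts (n : ℕ) (hn : 2 ≤ n) (heven : Even n) :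
    (cnatA n : ℚ) = ((cnatT n : ℚ) + (-1 : ℚ) ^ (n / 2) * (cnatT (n / 2) : ℚ)) / 2 ∧
    (cnatB n : ℚ) = ((cnatT n : ℚ) - (-1 : ℚ) ^ (n / 2) * (cnatT (n / 2) : ℚ)) / 2 := by
  obtain ⟨m, rfl⟩ := heven.two_dvd
  have hm : 2 * m / 2 = m := by omega
  rw [hm]
  have h1 := CNAT.sub_eq (n := 2 * m)
  rw [CNAT.sum_det, ← CNAT.cnatT_eq] at h1
  have h2 : (cnatA (2 * m) : ℚ) - cnatB (2 * m) = (-1) ^ m * (cnatT m : ℚ) := by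
    exact_mod_cast h1
  have h3 : (cnatT (2 * m) : ℚ) = cnatA (2 * m) + cnatB (2 * m) := by
    rw [cnatT]; push_cast; ring
  constructor <;> linarith
end
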